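/- arXiv:2512.12323 — 6 statements merged into one kernel-verified Lean document; each statement's English description precedes it below -/
import Mathlib

section
/- For all integers 1 ≤ k ≤ n and every radius 0 < r < 1, the Ewens–Pitman block-count probability has the contour-integral representation p_{n,k} = (n!/k!) · ((θ/α)_{k↑}/(θ)_{n↑}) · (1/(2πi)) ∮_{|z|=r} (1−(1−z)^α)^k / z^{n+1} dz, where the integral is over the circle of radius r centered at 0 traversed counterclockwise. -/
open MeasureTheory

/-- Rising factorial `(a)_{n↑} = Γ(a+n)/Γ(a)`. -/
noncomputable def rfac (a : ℝ) (n : ℕ) : ℝ := Real.Gamma (a + n) / Real.Gamma a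

/-- The Ewens–Pitman probability `p_{n,k}` that the number of blocks `K_n` equals `k`. -/
noncomputable def ewensP (α θ : ℝ) (n k : ℕ) : ℝ :=
  ∑' m : Fin n → ℕ,
    if (∑ j, m j = k ∧ ∑ j, (j.1 + 1) * m j = n) then
      (n.factorial : ℝ) * ((∏ i ∈ Finset.range k, (θ + i * α)) / rfac θ n) *
        ∏ j, ((rfac (1 - α) j.1 / Nat.factorial (j.1 + 1)) ^ (m j) /
          Nat.factorial (m j))
    else 0

open Filter Topology Asymptotics Set

theorem rfac_eq_prod {a : ℝ} (ha : 0 < a) (n : ℕ) :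
    rfac a n = ∏ i ∈ Finset.range n, (a + i) := by
  induction n with
  | zero => simp [rfac, (Real.Gamma_pos_of_pos ha).ne']
  | succ n ih =>
    have hpos : a + (n : ℝ) ≠ 0 := by positivity
    rw [Finset.prod_range_succ, ← ih, rfac, rfac, Nat.cast_succ, ← add_assoc,
      Real.Gamma_add_one hpos]
    ring

theorem prod_add_mul_eq_pow_mul_rfac {α θ : ℝ} (hα : 0 < α) (hθ : 0 < θ) (k : ℕ) :
    ∏ i ∈ Finset.range k, (θ + i * α) = α ^ k * rfac (θ / α) k := by
  rw [rfac_eq_prod (div_pos hθ hα), Finset.pow_eq_prod_const, ← Finset.prod_mul_distrib]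
  refine Finset.prod_congr rfl fun i _ => ?_
  field_simp

theorem ringChoose_succ_mul_neg_one_pow {α : ℝ} (hα : α < 1) (j : ℕ) :
    Ring.choose (α : ℂ) (j + 1) * (-1) ^ (j + 1) =
      -((α * (rfac (1 - α) j / (j + 1).factorial) : ℝ) : ℂ) := by
  have key : (descPochhammer ℤ (j + 1)).smeval (α : ℂ) * (-1) ^ (j + 1) =
      -((α * rfac (1 - α) j : ℝ) : ℂ) := by
    rw [rfac_eq_prod (sub_pos.2 hα)]
    induction j with
    | zero => simp
    | succ j ih =>
      have hrec : (descPochhammer ℤ (j + 1 + 1)).smeval (α : ℂ) =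
          (descPochhammer ℤ (j + 1)).smeval (α : ℂ) * (α - (j + 1)) := by
        rw [descPochhammer_succ_right, Polynomial.smeval_mul]
        simp [Polynomial.smeval_natCast]
      rw [hrec, Finset.prod_range_succ, pow_succ]
      push_cast at ih ⊢
      linear_combination ((j : ℂ) + 1 - α) * ih
  rw [Ring.choose_eq_smul, smul_eq_mul, mul_assoc, key]
  push_cast
  ring

theorem one_sub_mem_slitPlane {z : ℂ} (hz : ‖z‖ < 1) : 1 - z ∈ Complex.slitPlane := by
  simpa [sub_eq_add_neg] using Complex.mem_slitPlane_of_norm_lt_one (z := -z) (by simpa using hz)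

/-- Taylor expansion of `1 - (1 - z) ^ α` at the origin. -/
theorem one_sub_one_sub_cpow_sub_sum_isBigO {α : ℝ} (hα : α < 1) (n : ℕ) :
    (fun z : ℂ => (1 - (1 - z) ^ (α : ℂ)) -
      ∑ j : Fin n, ((α * (rfac (1 - α) j / (j.1 + 1).factorial) : ℝ) : ℂ) * z ^ (j.1 + 1))
      =O[𝓝 0] fun z => z ^ (n + 1) := by
  have h := (Complex.one_add_cpow_hasFPowerSeriesAt_zero (a := (α : ℂ))).isBigO_sub_partialSum_pow
    (n + 1)
  have hneg : Tendsto (fun z : ℂ => -z) (𝓝 0) (𝓝 0) := by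
    simpa using (continuous_neg (G := ℂ)).tendsto 0
  have h' := (h.comp_tendsto hneg).neg_left
  refine (h'.congr_left fun z => ?_).trans
    (isBigO_of_le _ fun z => by simp)
  simp only [Function.comp_apply, FormalMultilinearSeries.partialSum, zero_add,
    binomialSeries_apply, List.ofFn_const, List.prod_replicate, smul_eq_mul]
  rw [Finset.sum_range_succ', Finset.sum_range, Ring.choose_zero_right]
  have hterm (j : Fin n) : Ring.choose (α : ℂ) (j.1 + 1) * (-z) ^ (j.1 + 1) =
      -(((α * (rfac (1 - α) j / (j.1 + 1).factorial) : ℝ) : ℂ) * z ^ (j.1 + 1)) := by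
    rw [neg_pow, ← mul_assoc, ringChoose_succ_mul_neg_one_pow hα, neg_mul]
  simp only [hterm, Finset.sum_neg_distrib, sub_eq_add_neg 1 z]
  ring

theorem circleIntegral_div_pow_eq_zero_of_isBigO {f : ℂ → ℂ} {r R : ℝ} (hr : 0 < r) (hrR : r < R)
    {n : ℕ} (hf : DifferentiableOn ℂ f (Metric.ball 0 R)) (hO : f =O[𝓝 0] fun z => z ^ n) :
    ∮ z in C(0, r), f z / z ^ n = 0 := by
  set g : ℂ → ℂ := fun z => f z / z ^ n with hg
  have hgd : DifferentiableOn ℂ g (Metric.ball 0 R \ {0}) :=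
    (hf.mono sdiff_subset).div (by fun_prop) fun z hz => pow_ne_zero _ hz.2
  have hbdd : IsBoundedUnder (· ≤ ·) (𝓝[≠] (0 : ℂ)) fun z => ‖g z - g 0‖ := by
    obtain ⟨C, hC⟩ := hO.bound
    refine ⟨C + ‖g 0‖, eventually_map.2 ?_⟩
    filter_upwards [hC.filter_mono nhdsWithin_le_nhds, self_mem_nhdsWithin] with z hz hz0
    refine norm_sub_le_of_le ?_ le_rfl
    rw [hg, norm_div, div_le_iff₀ (norm_pos_iff.2 (pow_ne_zero _ hz0))]
    exact hz
  have hd := Complex.differentiableOn_update_limUnder_of_isLittleO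
    (Metric.ball_mem_nhds 0 (hr.trans hrR)) hgd hbdd.isLittleO_sub_self_inv
  have hcl : DiffContOnCl ℂ (Function.update g 0 (limUnder (𝓝[≠] 0) g)) (Metric.ball 0 r) :=
    (hd.mono ((Metric.closure_ball_subset_closedBall).trans
      (Metric.closedBall_subset_ball hrR))).diffContOnCl
  refine (circleIntegral.integral_congr hr.le fun z hz => ?_).trans
    (hcl.circleIntegral_eq_zero hr.le)
  rw [Function.update_of_ne (Metric.ne_of_mem_sphere hz hr.ne')]

theorem circleIntegral_pow_div_pow_succ {r : ℝ} (hr : 0 < r) (m n : ℕ) :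
    ∮ z in C(0, r), z ^ m / z ^ (n + 1) = if m = n then 2 * Real.pi * Complex.I else 0 := by
  have h : ∮ z in C(0, r), z ^ m / z ^ (n + 1) =
      ∮ z in C(0, r), (z - 0) ^ ((m : ℤ) - (n + 1)) := by
    refine circleIntegral.integral_congr hr.le fun z hz => ?_
    have hz0 : z ≠ 0 := Metric.ne_of_mem_sphere hz hr.ne'
    simp only [sub_zero]
    rw [zpow_sub₀ hz0]
    norm_cast
  rw [h]
  split_ifs with hmn
  · subst hmn
    simpa [sub_add_cancel_left] using circleIntegral.integral_sub_center_inv 0 hr.ne'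
  · exact circleIntegral.integral_sub_zpow_of_ne (by omega) _ _ _

/-- The `n`-th coefficient of the `k`-th power of a polynomial without constant term, as a contour
integral. -/
theorem circleIntegral_sum_pow_div_pow_succ {r : ℝ} (hr : 0 < r) (n k N : ℕ) (c : Fin N → ℂ) :
    ∮ z in C(0, r), (∑ j, c j * z ^ (j.1 + 1)) ^ k / z ^ (n + 1) =
      2 * Real.pi * Complex.I * ∑ m ∈ Finset.piAntidiag Finset.univ k,
        if ∑ j, (j.1 + 1) * m j = n then
          (Nat.multinomial Finset.univ m : ℂ) * ∏ j, c j ^ m j else 0 := by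
  have hexp (z : ℂ) : (∑ j, c j * z ^ (j.1 + 1)) ^ k / z ^ (n + 1) =
      ∑ m ∈ Finset.piAntidiag Finset.univ k,
        (Nat.multinomial Finset.univ m * ∏ j, c j ^ m j) *
          (z ^ (∑ j, (j.1 + 1) * m j) / z ^ (n + 1)) := by
    rw [Finset.sum_pow_eq_sum_piAntidiag, Finset.sum_div]
    refine Finset.sum_congr rfl fun m _ => ?_
    simp only [mul_pow, ← pow_mul, Finset.prod_mul_distrib, Finset.prod_pow_eq_pow_sum]
    ring
  simp only [hexp]
  rw [circleIntegral.integral_fun_sum, Finset.mul_sum]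
  · refine Finset.sum_congr rfl fun m _ => ?_
    rw [circleIntegral.integral_const_mul, circleIntegral_pow_div_pow_succ hr]
    split_ifs <;> ring
  · intro m _
    refine ContinuousOn.circleIntegrable hr.le (continuousOn_const.mul ?_)
    exact (by fun_prop : ContinuousOn _ _).div (by fun_prop)
      fun z hz => pow_ne_zero _ (Metric.ne_of_mem_sphere hz hr.ne')

theorem circleIntegral_one_sub_one_sub_cpow {α : ℝ} (hα : α < 1) {r : ℝ} (hr0 : 0 < r)
    (hr1 : r < 1) (n k : ℕ) :
    ∮ z in C(0, r), (1 - (1 - z) ^ (α : ℂ)) ^ k / z ^ (n + 1) =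
      ∮ z in C(0, r), (∑ j : Fin n,
        ((α * (rfac (1 - α) j / (j.1 + 1).factorial) : ℝ) : ℂ) * z ^ (j.1 + 1)) ^ k /
          z ^ (n + 1) := by
  set P : ℂ → ℂ := fun z => ∑ j : Fin n,
    ((α * (rfac (1 - α) j / (j.1 + 1).factorial) : ℝ) : ℂ) * z ^ (j.1 + 1)
  set f : ℂ → ℂ := fun z => 1 - (1 - z) ^ (α : ℂ)
  have hPd : Differentiable ℂ P := by fun_prop
  have hfd : DifferentiableOn ℂ f (Metric.ball 0 1) := by
    refine (differentiableOn_const _).sub (DifferentiableOn.cpow (by fun_prop) (by fun_prop) ?_)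
    exact fun z hz => one_sub_mem_slitPlane (by simpa using hz)
  have hfc : ContinuousAt f 0 :=
    (hfd.differentiableAt (Metric.ball_mem_nhds 0 one_pos)).continuousAt
  have hO : (fun z => f z ^ k - P z ^ k) =O[𝓝 0] fun z => z ^ (n + 1) := by
    have hfactor : (fun z => f z ^ k - P z ^ k) =
        fun z => (∑ i ∈ Finset.range k, f z ^ i * P z ^ (k - 1 - i)) * (f z - P z) := by
      funext z
      exact (Commute.all _ _).geom_sum₂_mul k |>.symm
    have hcont : ContinuousAt (fun z => ∑ i ∈ Finset.range k, f z ^ i * P z ^ (k - 1 - i)) 0 := by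
      have := hPd.continuous.continuousAt (x := 0)
      fun_prop
    rw [hfactor]
    exact ((hcont.isBigO_one ℂ).mul (one_sub_one_sub_cpow_sub_sum_isBigO hα n)).congr_right
      fun z => one_mul _
  have hzero := circleIntegral_div_pow_eq_zero_of_isBigO hr0 hr1
    ((hfd.pow k).sub (hPd.pow k).differentiableOn) hO
  have hint {h : ℂ → ℂ} (hh : ContinuousOn h (Metric.sphere 0 r)) :
      CircleIntegrable (fun z => h z / z ^ (n + 1)) 0 r :=
    (hh.div (by fun_prop) fun z hz =>
      pow_ne_zero _ (Metric.ne_of_mem_sphere hz hr0.ne')).circleIntegrable hr0.le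
  have hsub : Metric.sphere (0 : ℂ) r ⊆ Metric.ball 0 1 :=
    Metric.sphere_subset_closedBall.trans (Metric.closedBall_subset_ball hr1)
  simp only [sub_div, Pi.sub_apply] at hzero
  rw [circleIntegral.integral_sub (hint ((hfd.continuousOn.mono hsub).pow k))
    (hint (hPd.continuous.pow k).continuousOn)] at hzero
  exact sub_eq_zero.1 hzero

theorem ewensP_eq_sum_piAntidiag {α θ : ℝ} (hα : 0 < α) (hθ : 0 < θ) (n k : ℕ) :
    ewensP α θ n k = (n.factorial : ℝ) / k.factorial * (rfac (θ / α) k / rfac θ n) *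
      ∑ m ∈ Finset.piAntidiag Finset.univ k, if ∑ j : Fin n, (j.1 + 1) * m j = n then
        (Nat.multinomial Finset.univ m : ℝ) *
          ∏ j : Fin n, (α * (rfac (1 - α) j / (j.1 + 1).factorial)) ^ m j else 0 := by
  rw [ewensP, tsum_eq_sum (s := Finset.piAntidiag Finset.univ k), Finset.mul_sum]
  · refine Finset.sum_congr rfl fun m hm => ?_
    have hmk : ∑ j, m j = k := (Finset.mem_piAntidiag.1 hm).1
    by_cases hmn : ∑ j : Fin n, (j.1 + 1) * m j = n
    · have hspec : (∏ j, ((m j).factorial : ℝ)) * Nat.multinomial Finset.univ m = k.factorial := by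
        rw [← hmk]
        exact_mod_cast Nat.multinomial_spec Finset.univ m
      have hfac : ∏ j, ((m j).factorial : ℝ) ≠ 0 :=
        Finset.prod_ne_zero_iff.2 fun j _ => Nat.cast_ne_zero.2 (Nat.factorial_ne_zero _)
      have hmult : (Nat.multinomial Finset.univ m : ℝ) =
          k.factorial / ∏ j, ((m j).factorial : ℝ) := by
        rw [eq_div_iff hfac, mul_comm, hspec]
      have hkf : (k.factorial : ℝ) ≠ 0 := Nat.cast_ne_zero.2 (Nat.factorial_ne_zero _)
      rw [if_pos ⟨hmk, hmn⟩, if_pos hmn, prod_add_mul_eq_pow_mul_rfac hα hθ, hmult]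
      simp only [mul_pow, Finset.prod_mul_distrib, Finset.prod_div_distrib,
        Finset.prod_pow_eq_pow_sum, hmk]
      field_simp
    · rw [if_neg fun h => hmn h.2, if_neg hmn, mul_zero]
  · intro m hm
    refine if_neg fun h => hm ?_
    simpa using h.1

/-- contour-integral representation of the Ewens–Pitman block-count
probability: `p_{n,k} = (n!/k!) ((θ/α)_{k↑}/(θ)_{n↑}) (1/(2πi)) ∮_{|z|=r}
(1-(1-z)^α)^k / z^{n+1} dz` for `1 ≤ k ≤ n` and `0 < r < 1`. -/
theorem ewensP_contour_integral (α θ : ℝ) (hα : α ∈ Set.Ioo (0 : ℝ) 1) (hθ : 0 < θ)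
    (n k : ℕ) (hk : 1 ≤ k) (hkn : k ≤ n) (r : ℝ) (hr0 : 0 < r) (hr1 : r < 1) :
    (ewensP α θ n k : ℂ) =
      (((n.factorial : ℝ) / k.factorial : ℝ) : ℂ) *
        ((rfac (θ / α) k / rfac θ n : ℝ) : ℂ) *
        ((2 * Real.pi * Complex.I)⁻¹ *
          ∮ z in C(0, r), (1 - (1 - z) ^ (α : ℂ)) ^ k / z ^ (n + 1)) := by
  rw [circleIntegral_one_sub_one_sub_cpow hα.2 hr0 hr1, circleIntegral_sum_pow_div_pow_succ hr0,
    inv_mul_cancel_left₀ Complex.two_pi_I_ne_zero, ewensP_eq_sum_piAntidiag hα.1 hθ]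
  simp only [Complex.ofReal_mul, Complex.ofReal_sum, apply_ite Complex.ofReal,
    Complex.ofReal_prod, Complex.ofReal_pow, Complex.ofReal_natCast, Complex.ofReal_zero]
end

section
/- There exists a constant C > 0 such that for all integers 1 ≤ k ≤ n, writing x_k = k/n, one has | [ (n!/k!) · ((θ/α)_{k↑}/(θ)_{n↑}) ] / [ (Γ(θ)/Γ(θ/α)) · n^{(1/α−1)θ} · x_k^{θ/α−1} ] − 1 | ≤ C/k. -/
open Real in
/-- Log-convexity of `Γ` compares `log Γ (m + 1 + a) - log Γ (m + 1)` with `a * log m`. -/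
theorem log_Gamma_add_sub_bounds {a m : ℝ} (ha : 0 < a) (hm : 0 < m) :
    a * log m ≤ log (Gamma (m + 1 + a)) - log (Gamma (m + 1)) ∧
      log (Gamma (m + 1 + a)) - log (Gamma (m + 1)) ≤ a * log (m + 1 + a) := by
  have step : ∀ y : ℝ, 0 < y → log (Gamma (y + 1)) = log y + log (Gamma y) := fun y hy ↦ by
    rw [Gamma_add_one hy.ne', log_mul hy.ne' (Gamma_pos_of_pos hy).ne']
  have lower := convexOn_log_Gamma.slope_mono_adjacent (x := m) (y := m + 1) (z := m + 1 + a)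
    (Set.mem_Ioi.2 hm) (Set.mem_Ioi.2 (by linarith)) (by linarith) (by linarith)
  have upper := convexOn_log_Gamma.slope_mono_adjacent
    (x := m + 1) (y := m + 1 + a) (z := m + 1 + a + 1)
    (Set.mem_Ioi.2 (by linarith)) (Set.mem_Ioi.2 (by linarith)) (by linarith) (by linarith)
  simp only [Function.comp_apply, add_sub_cancel_left, div_one] at lower upper
  rw [le_div_iff₀ ha, step m hm] at lower
  rw [div_le_iff₀ ha, step (m + 1 + a) (by linarith)] at upper
  constructor
  · rw [step m hm]
    linarith
  · linarith

open Real in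
/-- `log (m + a) - log m` lies between `0` and `a / m`. -/
theorem log_add_sub_log_bounds {a m : ℝ} (ha : 0 < a) (hm : 0 < m) :
    0 ≤ log (m + a) - log m ∧ log (m + a) - log m ≤ a / m := by
  constructor
  · exact sub_nonneg.2 (log_le_log hm (by linarith))
  · rw [← log_div (by positivity) hm.ne']
    refine (log_le_sub_one_of_pos (by positivity)).trans_eq ?_
    field_simp
    ring

open Real in
/-- `Γ (a + m) = m! * m ^ (a - 1) * exp e` with an error `e = O(1 / m)`. -/
theorem exists_Gamma_add_nat_eq {a : ℝ} (ha : 0 < a) {m : ℕ} (hm : 1 ≤ m) :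
    ∃ e : ℝ, |e| ≤ a * (a + 2) / m ∧
      Gamma (a + m) = m.factorial * (m : ℝ) ^ (a - 1) * exp e := by
  have hm' : (0 : ℝ) < m := by exact_mod_cast hm
  have hfac : (0 : ℝ) < m.factorial := by exact_mod_cast m.factorial_pos
  have hG : 0 < Gamma (a + m) := Gamma_pos_of_pos (by positivity)
  refine ⟨log (Gamma (a + m)) - log m.factorial - (a - 1) * log m, ?_, ?_⟩
  · obtain ⟨h₁, h₂⟩ := log_Gamma_add_sub_bounds ha hm'
    obtain ⟨h₃, h₄⟩ := log_add_sub_log_bounds ha hm'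
    obtain ⟨-, h₅⟩ := log_add_sub_log_bounds (a := 1 + a) (by linarith) hm'
    have h₆ := mul_le_mul_of_nonneg_left h₅ ha.le
    have hstep : log (Gamma (m + 1 + a)) = log (m + a) + log (Gamma (a + m)) := by
      rw [show (m : ℝ) + 1 + a = (a + m) + 1 by ring, Gamma_add_one (by positivity),
        log_mul (by positivity) hG.ne', add_comm a]
    rw [hstep, Gamma_nat_eq_factorial] at h₁ h₂
    rw [← add_assoc] at h₆
    have hsplit : a * (a + 2) / m = a * ((1 + a) / m) + a / m := by ring
    have hpos : 0 ≤ a * ((1 + a) / m) := by positivity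
    rw [hsplit, abs_le]
    constructor <;> linarith
  · rw [exp_sub, exp_sub, exp_log hG, exp_log hfac, rpow_def_of_pos hm', mul_comm (log (m : ℝ))]
    field_simp

open Real in
theorem abs_exp_sub_one_le_mul_exp_abs (u : ℝ) : |exp u - 1| ≤ |u| * exp |u| := by
  have h₁ := add_one_le_exp u
  have h₂ : exp u - 1 ≤ u * exp u := by
    have h := mul_le_mul_of_nonneg_right (add_one_le_exp (-u)) (exp_pos u).le
    rw [← exp_add, neg_add_cancel, exp_zero] at h
    linarith
  have h₃ : u * exp u ≤ |u| * exp |u| :=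
    mul_le_mul (le_abs_self u) (exp_le_exp.2 (le_abs_self u)) (exp_pos u).le (abs_nonneg u)
  have h₄ : |u| ≤ |u| * exp |u| :=
    le_mul_of_one_le_right (abs_nonneg u) (one_le_exp (abs_nonneg u))
  rw [abs_le]
  constructor
  · linarith [neg_abs_le u]
  · linarith

/-- there is a constant `C > 0` such that for all `1 ≤ k ≤ n`, with
`x_k = k/n`, the coefficient `(n!/k!) ((θ/α)_{k↑}/(θ)_{n↑})` equals
`(Γ(θ)/Γ(θ/α)) n^{(1/α-1)θ} x_k^{θ/α-1}` up to a relative error at most `C/k`. -/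
theorem coefficient_asymptotics (α θ : ℝ) (hα : α ∈ Set.Ioo (0 : ℝ) 1) (hθ : 0 < θ) :
    ∃ C > (0 : ℝ), ∀ n k : ℕ, 1 ≤ k → k ≤ n →
      |(((n.factorial : ℝ) / k.factorial) * (rfac (θ / α) k / rfac θ n)) /
          ((Real.Gamma θ / Real.Gamma (θ / α)) * (n : ℝ) ^ ((1 / α - 1) * θ) *
            ((k : ℝ) / n) ^ (θ / α - 1)) - 1| ≤ C / k := by
  have hb : 0 < θ / α := div_pos hθ hα.1
  have hexp : (1 / α - 1) * θ = (θ / α - 1) - (θ - 1) := by ring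
  rw [hexp]
  generalize θ / α = b at hb ⊢
  set K := b * (b + 2) + θ * (θ + 2) with hK
  have hKpos : 0 < K := by positivity
  refine ⟨K * Real.exp K, by positivity, fun n k hk hkn ↦ ?_⟩
  have hk' : (1 : ℝ) ≤ k := by exact_mod_cast hk
  have hkn' : (k : ℝ) ≤ n := by exact_mod_cast hkn
  have hk0 : (0 : ℝ) < k := by linarith
  have hn0 : (0 : ℝ) < n := by linarith
  obtain ⟨e, he, hGk⟩ := exists_Gamma_add_nat_eq hb hk
  obtain ⟨d, hd, hGn⟩ := exists_Gamma_add_nat_eq hθ (hk.trans hkn)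
  have hratio : (((n.factorial : ℝ) / k.factorial) * (rfac b k / rfac θ n)) /
      ((Real.Gamma θ / Real.Gamma b) * (n : ℝ) ^ ((b - 1) - (θ - 1)) *
        ((k : ℝ) / n) ^ (b - 1)) = Real.exp (e - d) := by
    have hΓb := (Real.Gamma_pos_of_pos hb).ne'
    have hΓθ := (Real.Gamma_pos_of_pos hθ).ne'
    have hkfac : (k.factorial : ℝ) ≠ 0 := by exact_mod_cast k.factorial_ne_zero
    have hnfac : (n.factorial : ℝ) ≠ 0 := by exact_mod_cast n.factorial_ne_zero
    have hkb := (Real.rpow_pos_of_pos hk0 (b - 1)).ne'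
    have hnb := (Real.rpow_pos_of_pos hn0 (b - 1)).ne'
    have hnθ := (Real.rpow_pos_of_pos hn0 (θ - 1)).ne'
    rw [rfac, rfac, hGk, hGn, Real.rpow_sub hn0 (b - 1), Real.div_rpow hk0.le hn0.le, Real.exp_sub]
    generalize (k : ℝ) ^ (b - 1) = x at *
    generalize (n : ℝ) ^ (b - 1) = y at *
    generalize (n : ℝ) ^ (θ - 1) = z at *
    field_simp
  have hu : |e - d| ≤ K / k := by
    have hdk : θ * (θ + 2) / n ≤ θ * (θ + 2) / k := by gcongr
    calc |e - d| ≤ |e| + |d| := abs_sub e d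
      _ ≤ b * (b + 2) / k + θ * (θ + 2) / k := by linarith
      _ = K / k := by rw [hK]; ring
  rw [hratio]
  calc |Real.exp (e - d) - 1| ≤ |e - d| * Real.exp |e - d| := abs_exp_sub_one_le_mul_exp_abs _
    _ ≤ K / k * Real.exp K := by
      gcongr
      exact hu.trans (div_le_self hKpos.le hk')
    _ = K * Real.exp K / k := by ring
end

section
/- For every x ∈ (0,1) there exists exactly one z ∈ (0,1) satisfying 1 − (1−z)^α − α·x·z·(1−z)^{α−1} = 0; equivalently, the function h_x(z) = ln z − x·ln(1−(1−z)^α) has exactly one critical point z(x) in (0,1). -/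
/-- The function `h_x(z) = ln z - x ln(1-(1-z)^α)` for `z ∈ (0,1)`. -/
noncomputable def hfun (α x : ℝ) : ℝ → ℝ :=
  fun z => Real.log z - x * Real.log (1 - (1 - z) ^ α)

open Set

/-- In the variable `w = 1 - z`, the saddle point equation says that `w ^ (1 - α)` meets the
chord `w + α x (1 - w)`. -/
lemma saddle_eq_iff_rpow_eq_chord (α x : ℝ) {z : ℝ} (hz : z < 1) :
    1 - (1 - z) ^ α - α * x * z * (1 - z) ^ (α - 1) = 0 ↔
      (1 - z) ^ (1 - α) = (1 - z) + α * x * z := by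
  have hw : 0 < 1 - z := by linarith
  have hpos : 0 < (1 - z) ^ (1 - α) := Real.rpow_pos_of_pos hw _
  have hmul : (1 - z) ^ (1 - α) * (1 - z) ^ α = 1 - z := by
    rw [← Real.rpow_add hw]; simp
  have hinv : (1 - z) ^ (1 - α) * (1 - z) ^ (α - 1) = 1 := by
    rw [← Real.rpow_add hw]; simp
  have key : (1 - z) ^ (1 - α) * (1 - (1 - z) ^ α - α * x * z * (1 - z) ^ (α - 1)) =
      (1 - z) ^ (1 - α) - ((1 - z) + α * x * z) := by
    linear_combination -hmul - α * x * z * hinv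
  rw [← sub_eq_zero (a := (1 - z) ^ (1 - α)), ← key, mul_eq_zero, or_iff_right (ne_of_gt hpos)]

/-- A strictly concave power meets a line through `(1, 1)` at most once in `(0, 1)`. -/
lemma not_rpow_eq_chord_of_lt {p c a b : ℝ} (hp0 : 0 < p) (hp1 : p < 1)
    (ha0 : 0 < a) (hab : a < b) (hb1 : b < 1)
    (ha : a ^ p = a + c * (1 - a)) (hb : b ^ p = b + c * (1 - b)) : False := by
  have h := (Real.strictConcaveOn_rpow hp0 hp1).slope_anti_adjacent
    (mem_Ici.2 ha0.le) (mem_Ici.2 zero_le_one) hab hb1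
  have h1 : (1 - (b + c * (1 - b))) / (1 - b) = 1 - c := by
    rw [div_eq_iff (sub_pos.2 hb1).ne']; ring
  have h2 : (b + c * (1 - b) - (a + c * (1 - a))) / (b - a) = 1 - c := by
    rw [div_eq_iff (sub_pos.2 hab).ne']; ring
  rw [Real.one_rpow, ha, hb, h1, h2] at h
  exact lt_irrefl _ h

lemma add_mul_le_rpow_one_sub {α w : ℝ} (hα : 0 ≤ α) (hw : 0 < w) :
    w + α * w * (1 - w) ≤ w ^ (1 - α) := by
  have hexp : w ^ (1 - α) = w * Real.exp (Real.log w * -α) := by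
    rw [← Real.rpow_def_of_pos hw, sub_eq_add_neg, Real.rpow_add hw, Real.rpow_one]
  have h1 := Real.add_one_le_exp (Real.log w * -α)
  have h2 := mul_le_mul_of_nonneg_left (Real.log_le_sub_one_of_pos hw) hα
  have h3 : 1 + α * (1 - w) ≤ Real.exp (Real.log w * -α) := by linarith
  have h4 := mul_le_mul_of_nonneg_left h3 hw.le
  rw [hexp]
  linarith

lemma exists_rpow_eq_chord {α x : ℝ} (hα : α ∈ Ioo (0 : ℝ) 1) (hx : x ∈ Ioo (0 : ℝ) 1) :
    ∃ w ∈ Ioo (0 : ℝ) 1, w ^ (1 - α) = w + α * x * (1 - w) := by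
  obtain ⟨hα0, hα1⟩ := hα
  obtain ⟨hx0, hx1⟩ := hx
  have hcont : Continuous fun w : ℝ => w ^ (1 - α) - (w + α * x * (1 - w)) :=
    (Real.continuous_rpow_const (sub_nonneg.2 hα1.le)).sub (by fun_prop)
  have hmid : (0 : ℝ) < (1 + x) / 2 := by linarith
  have hle := add_mul_le_rpow_one_sub hα0.le hmid
  have hsq : 0 < α * (1 - x) ^ 2 := mul_pos hα0 (pow_pos (sub_pos.2 hx1) 2)
  have hneg : (0 : ℝ) ^ (1 - α) - (0 + α * x * (1 - 0)) < 0 := by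
    rw [Real.zero_rpow (sub_pos.2 hα1).ne']
    linarith [mul_pos hα0 hx0]
  have hpos : 0 < ((1 + x) / 2) ^ (1 - α) - ((1 + x) / 2 + α * x * (1 - (1 + x) / 2)) := by
    linarith
  obtain ⟨w, hw, hw0⟩ := intermediate_value_Ioo hmid.le hcont.continuousOn ⟨hneg, hpos⟩
  exact ⟨w, ⟨hw.1, by linarith [hw.2]⟩, sub_eq_zero.1 hw0⟩

lemma deriv_hfun_eq_zero_iff {α : ℝ} (hα : 0 < α) (x : ℝ) {z : ℝ} (hz : z ∈ Ioo (0 : ℝ) 1) :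
    deriv (hfun α x) z = 0 ↔ 1 - (1 - z) ^ α - α * x * z * (1 - z) ^ (α - 1) = 0 := by
  obtain ⟨hz0, hz1⟩ := hz
  have hw : 0 < 1 - z := sub_pos.2 hz1
  have hden : 0 < 1 - (1 - z) ^ α :=
    sub_pos.2 (Real.rpow_lt_one hw.le (by linarith) hα)
  have hderiv := (Real.hasDerivAt_log hz0.ne').sub
    ((((((hasDerivAt_id z).const_sub 1).rpow_const (p := α) (Or.inl hw.ne')).const_sub 1).log
      hden.ne').const_mul x)
  have heq : deriv (hfun α x) z =
      (1 - (1 - z) ^ α - α * x * z * (1 - z) ^ (α - 1)) / (z * (1 - (1 - z) ^ α)) := by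
    refine (HasDerivAt.deriv hderiv).trans ?_
    simp only [id]
    field_simp
  rw [heq, div_eq_zero_iff, or_iff_left (ne_of_gt (mul_pos hz0 hden))]

/-- for every `x ∈ (0,1)` there is exactly one `z ∈ (0,1)` with
`1 - (1-z)^α - αxz(1-z)^{α-1} = 0`; equivalently `h_x` has exactly one critical
point in `(0,1)`. -/
theorem unique_saddle_point (α : ℝ) (hα : α ∈ Set.Ioo (0 : ℝ) 1) :
    ∀ x ∈ Set.Ioo (0 : ℝ) 1,
      (∃! z : ℝ, z ∈ Set.Ioo (0 : ℝ) 1 ∧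
        1 - (1 - z) ^ α - α * x * z * (1 - z) ^ (α - 1) = 0) ∧
      (∃! z : ℝ, z ∈ Set.Ioo (0 : ℝ) 1 ∧ deriv (hfun α x) z = 0) := by
  intro x hx
  have huniq : ∃! z : ℝ, z ∈ Set.Ioo (0 : ℝ) 1 ∧
      1 - (1 - z) ^ α - α * x * z * (1 - z) ^ (α - 1) = 0 := by
    refine existsUnique_of_exists_of_unique ?_ ?_
    · obtain ⟨w, ⟨hw0, hw1⟩, hw⟩ := exists_rpow_eq_chord hα hx
      refine ⟨1 - w, ⟨by linarith, by linarith⟩, ?_⟩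
      rw [saddle_eq_iff_rpow_eq_chord α x (by linarith), sub_sub_cancel]
      exact hw
    · have hnot : ∀ y z : ℝ, y ∈ Ioo (0 : ℝ) 1 → z ∈ Ioo (0 : ℝ) 1 →
          1 - (1 - y) ^ α - α * x * y * (1 - y) ^ (α - 1) = 0 →
          1 - (1 - z) ^ α - α * x * z * (1 - z) ^ (α - 1) = 0 → ¬ y < z := by
        intro y z hy hz hy' hz' hlt
        rw [saddle_eq_iff_rpow_eq_chord α x hy.2] at hy'
        rw [saddle_eq_iff_rpow_eq_chord α x hz.2] at hz'
        refine not_rpow_eq_chord_of_lt (p := 1 - α) (c := α * x) (a := 1 - z) (b := 1 - y)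
          (sub_pos.2 hα.2) (sub_lt_self _ hα.1) (sub_pos.2 hz.2) (sub_lt_sub_left hlt _)
          (sub_lt_self _ hy.1) ?_ ?_ <;> rwa [sub_sub_cancel]
      rintro y z ⟨hy, hy'⟩ ⟨hz, hz'⟩
      exact le_antisymm (not_lt.1 (hnot z y hz hy hz' hy')) (not_lt.1 (hnot y z hy hz hy' hz'))
  refine ⟨huniq, (existsUnique_congr fun z => ?_).2 huniq⟩
  exact and_congr_right fun hz => deriv_hfun_eq_zero_iff hα.1 x hz
end

section
/- Fix x ∈ (0,1) and let z(x) ∈ (0,1) be the unique critical point of h_x on (0,1). Then h_x′(z) > 0 for all z ∈ (0, z(x)) and h_x′(z) < 0 for all z ∈ (z(x), 1); consequently h_x(z(x)) = sup_{z∈(0,1)} h_x(z), and moreover h_x″(z(x)) < 0. -/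
/-- The sign-carrying factor of `h_x'` as a function of `w = 1 - z`. -/
noncomputable def derivNumerator (α x w : ℝ) : ℝ :=
  w ^ (1 - α) + ((x * α - 1) * w - x * α)

/-- The positive factor of `h_x'` as a function of `z`. -/
noncomputable def derivDenominator (α z : ℝ) : ℝ :=
  z * ((1 - z) ^ (1 - α) * (1 - (1 - z) ^ α))

theorem derivNumerator_one (α x : ℝ) : derivNumerator α x 1 = 0 := by
  simp [derivNumerator]

theorem strictConcaveOn_derivNumerator {α : ℝ} (hα : α ∈ Set.Ioo (0 : ℝ) 1) (x : ℝ) :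
    StrictConcaveOn ℝ (Set.Ici 0) (derivNumerator α x) := by
  refine (Real.strictConcaveOn_rpow (p := 1 - α) (by linarith [hα.2])
    (by linarith [hα.1])).add_concaveOn (g := fun w => (x * α - 1) * w - x * α)
    ⟨convex_Ici 0, fun a _ b _ s t _ _ hst => ?_⟩
  simp only [smul_eq_mul]
  nlinarith [congrArg (x * α * ·) hst]

theorem differentiableAt_derivNumerator (α x : ℝ) {w : ℝ} (hw : w ≠ 0) :
    DifferentiableAt ℝ (derivNumerator α x) w := by
  unfold derivNumerator
  fun_prop (disch := assumption)

theorem one_sub_rpow_one_sub_pos {α z : ℝ} (hα : 0 < α) (hz : z ∈ Set.Ioo (0 : ℝ) 1) :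
    0 < 1 - (1 - z) ^ α := by
  linarith [Real.rpow_lt_one (x := 1 - z) (by linarith [hz.2]) (by linarith [hz.1]) hα]

theorem derivDenominator_pos {α z : ℝ} (hα : 0 < α) (hz : z ∈ Set.Ioo (0 : ℝ) 1) :
    0 < derivDenominator α z :=
  mul_pos hz.1 (mul_pos (Real.rpow_pos_of_pos (by linarith [hz.2]) _)
    (one_sub_rpow_one_sub_pos hα hz))

theorem differentiableAt_derivDenominator (α : ℝ) {z : ℝ} (hz : z < 1) :
    DifferentiableAt ℝ (derivDenominator α) z := by
  have hw : 1 - z ≠ 0 := by linarith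
  unfold derivDenominator
  fun_prop (disch := assumption)

theorem hasDerivAt_hfun {α x z : ℝ} (hα : 0 < α) (hz : z ∈ Set.Ioo (0 : ℝ) 1) :
    HasDerivAt (hfun α x) (derivNumerator α x (1 - z) / derivDenominator α z) z := by
  have hw : 0 < 1 - z := by linarith [hz.2]
  have hpos := one_sub_rpow_one_sub_pos hα hz
  have hd := (Real.hasDerivAt_log hz.1.ne').sub
    ((((((hasDerivAt_id z).const_sub 1).rpow_const (p := α) (Or.inl hw.ne')).const_sub 1).log
      hpos.ne').const_mul x)
  refine hd.congr_deriv ?_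
  have hmul : (1 - z) ^ (1 - α) * (1 - z) ^ α = 1 - z := by
    rw [← Real.rpow_add hw]; simp
  have hmul' : (1 - z) ^ (1 - α) * (1 - z) ^ (α - 1) = 1 := by
    rw [← Real.rpow_add hw]; simp
  have hne := (Real.rpow_pos_of_pos hw (1 - α)).ne'
  have hz0 := hz.1.ne'
  have hpos' := hpos.ne'
  simp only [derivNumerator, derivDenominator, id]
  rw [eq_div_iff (by positivity)]
  generalize (1 - z) ^ (1 - α) = A at *
  generalize (1 - z) ^ (α - 1) = B at *
  generalize (1 - z) ^ α = C at *
  field_simp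
  linear_combination (-1) * hmul - x * z * α * hmul'

theorem derivNumerator_pos {α x w₀ w : ℝ} (hα : α ∈ Set.Ioo (0 : ℝ) 1) (hw₀ : 0 ≤ w₀)
    (h : derivNumerator α x w₀ = 0) (hw : w ∈ Set.Ioo w₀ 1) : 0 < derivNumerator α x w := by
  have key := (strictConcaveOn_derivNumerator hα x).lt_on_openSegment (x := w₀) (y := 1)
    hw₀ (Set.mem_Ici.2 zero_le_one) (hw.1.trans hw.2).ne
    ((openSegment_eq_Ioo (hw.1.trans hw.2)).ge hw)
  simpa [h, derivNumerator_one] using key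

theorem derivNumerator_neg {α x w₀ w : ℝ} (hα : α ∈ Set.Ioo (0 : ℝ) 1) (hw : 0 ≤ w)
    (h : derivNumerator α x w₀ = 0) (hlt : w < w₀) (hw₀ : w₀ < 1) :
    derivNumerator α x w < 0 := by
  by_contra! hle
  have key := (strictConcaveOn_derivNumerator hα x).lt_on_openSegment (x := w) (y := 1)
    hw (Set.mem_Ici.2 zero_le_one) (hlt.trans hw₀).ne
    ((openSegment_eq_Ioo (hlt.trans hw₀)).ge ⟨hlt, hw₀⟩)
  simp [h, derivNumerator_one, hle] at key

theorem deriv_derivNumerator_pos {α x w₀ : ℝ} (hα : α ∈ Set.Ioo (0 : ℝ) 1)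
    (hw₀ : w₀ ∈ Set.Ioo (0 : ℝ) 1) (h : derivNumerator α x w₀ = 0) :
    0 < deriv (derivNumerator α x) w₀ := by
  have key := (strictConcaveOn_derivNumerator hα x).slope_lt_deriv (y := 1) hw₀.1.le
    (Set.mem_Ici.2 zero_le_one) hw₀.2 (differentiableAt_derivNumerator α x hw₀.1.ne')
  simpa [slope_def_field, h, derivNumerator_one] using key

/-- if `z(x) ∈ (0,1)` is the critical point of `h_x`, then `h_x' > 0`
on `(0, z(x))` and `h_x' < 0` on `(z(x), 1)`; consequently `h_x(z(x))` is the
supremum of `h_x` on `(0,1)`, and `h_x''(z(x)) < 0`. -/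
theorem saddle_point_is_max (α : ℝ) (hα : α ∈ Set.Ioo (0 : ℝ) 1)
    (x : ℝ) (hx : x ∈ Set.Ioo (0 : ℝ) 1)
    (zx : ℝ) (hzx : zx ∈ Set.Ioo (0 : ℝ) 1) (hcrit : deriv (hfun α x) zx = 0) :
    (∀ z ∈ Set.Ioo (0 : ℝ) zx, 0 < deriv (hfun α x) z) ∧
    (∀ z ∈ Set.Ioo zx (1 : ℝ), deriv (hfun α x) z < 0) ∧
    IsGreatest (hfun α x '' Set.Ioo (0 : ℝ) 1) (hfun α x zx) ∧
    deriv (deriv (hfun α x)) zx < 0 := by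
  have hderiv : ∀ z ∈ Set.Ioo (0 : ℝ) 1, deriv (hfun α x) z =
      derivNumerator α x (1 - z) / derivDenominator α z :=
    fun z hz => (hasDerivAt_hfun hα.1 hz).deriv
  have hroot : derivNumerator α x (1 - zx) = 0 := by
    rw [hderiv zx hzx, div_eq_zero_iff] at hcrit
    exact hcrit.resolve_right (derivDenominator_pos hα.1 hzx).ne'
  have hpos : ∀ z ∈ Set.Ioo (0 : ℝ) zx, 0 < deriv (hfun α x) z := fun z hz => by
    have hz' : z ∈ Set.Ioo (0 : ℝ) 1 := ⟨hz.1, hz.2.trans hzx.2⟩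
    rw [hderiv z hz']
    exact div_pos (derivNumerator_pos hα (by linarith [hzx.2]) hroot
      ⟨by linarith [hz.2], by linarith [hz.1]⟩) (derivDenominator_pos hα.1 hz')
  have hneg : ∀ z ∈ Set.Ioo zx (1 : ℝ), deriv (hfun α x) z < 0 := fun z hz => by
    have hz' : z ∈ Set.Ioo (0 : ℝ) 1 := ⟨hzx.1.trans hz.1, hz.2⟩
    rw [hderiv z hz']
    exact div_neg_of_neg_of_pos (derivNumerator_neg hα (by linarith [hz.2]) hroot
      (by linarith [hz.1]) (by linarith [hzx.1])) (derivDenominator_pos hα.1 hz')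
  have hcont : ContinuousOn (hfun α x) (Set.Ioo 0 1) := fun z hz =>
    (hasDerivAt_hfun hα.1 hz).continuousAt.continuousWithinAt
  refine ⟨hpos, hneg, ⟨Set.mem_image_of_mem _ hzx, ?_⟩, ?_⟩
  · rintro _ ⟨z, hz, rfl⟩
    rcases le_total z zx with hle | hle
    · exact (strictMonoOn_of_deriv_pos (convex_Ioc 0 zx)
        (hcont.mono fun y hy => ⟨hy.1, hy.2.trans_lt hzx.2⟩)
        (by simpa only [interior_Ioc] using hpos)).monotoneOn ⟨hz.1, hle⟩ ⟨hzx.1, le_rfl⟩ hle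
    · exact (strictAntiOn_of_deriv_neg (convex_Ico zx 1)
        (hcont.mono fun y hy => ⟨hzx.1.trans_le hy.1, hy.2⟩)
        (by simpa only [interior_Ico] using hneg)).antitoneOn ⟨le_rfl, hzx.2⟩ ⟨hle, hz.2⟩ hle
  · have hw : 1 - zx ∈ Set.Ioo (0 : ℝ) 1 := ⟨by linarith [hzx.2], by linarith [hzx.1]⟩
    have hD := derivDenominator_pos hα.1 hzx
    have heq : deriv (hfun α x) =ᶠ[nhds zx]
        fun z => derivNumerator α x (1 - z) / derivDenominator α z :=
      Filter.eventually_of_mem (Ioo_mem_nhds hzx.1 hzx.2) hderiv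
    have hnum : HasDerivAt (fun z => derivNumerator α x (1 - z))
        (-deriv (derivNumerator α x) (1 - zx)) zx :=
      (differentiableAt_derivNumerator α x hw.1.ne').hasDerivAt.comp_const_sub 1 zx
    have hquot := hnum.fun_div (differentiableAt_derivDenominator α hzx.2).hasDerivAt hD.ne'
    rw [heq.deriv_eq, hquot.deriv, hroot, zero_mul, sub_zero]
    exact div_neg_of_neg_of_pos
      (mul_neg_of_neg_of_pos (neg_neg_of_pos (deriv_derivNumerator_pos hα hw hroot)) hD)
      (pow_pos hD 2)
end

section
/- For every compact interval [a,b] ⊂ (0,1) there exists a constant C > 0 such that for all integers n ≥ 1 and 1 ≤ k ≤ n with x_k := k/n ∈ [a,b], writing z* = z(x_k), one has | (1/(2π)) ∫_{−∞}^{∞} (1−(1−(z*+it))^α)^k / (z*+it)^{n+1} dt − G_{n,k} | ≤ (C/n)·G_{n,k}, where G_{n,k} = e^{−n·h_{x_k}(z*)} / ( z* · √(2π·n·|h_{x_k}″(z*)|) ). -/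
open MeasureTheory

/-- The complex function `1 - (1 - z) ^ α`. -/
noncomputable def oneSubPow (α : ℝ) (z : ℂ) : ℂ := 1 - (1 - z) ^ (α : ℂ)

/-- The open vertical strip `0 < Re z < 1`. -/
def unitStrip : Set ℂ := {z | 0 < z.re ∧ z.re < 1}

theorem isOpen_unitStrip : IsOpen unitStrip :=
  (isOpen_lt continuous_const Complex.continuous_re).inter
    (isOpen_lt Complex.continuous_re continuous_const)

theorem one_sub_rpow_pos {α y : ℝ} (hα : 0 < α) (hy : y ∈ Set.Ioo (0 : ℝ) 1) :
    0 < 1 - (1 - y) ^ α := by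
  have := Real.rpow_lt_one (x := 1 - y) (z := α) (by linarith [hy.2]) (by linarith [hy.1]) hα
  linarith

theorem oneSubPow_ofReal {α y : ℝ} (hy : y ≤ 1) :
    oneSubPow α (y : ℂ) = ((1 - (1 - y) ^ α : ℝ) : ℂ) := by
  rw [oneSubPow]
  push_cast
  rw [Complex.ofReal_cpow (by linarith)]
  push_cast
  rfl

theorem oneSubPow_mem_slitPlane {α : ℝ} (hα : α ∈ Set.Ioo (0 : ℝ) 1) {z : ℂ}
    (hz : z ∈ unitStrip) : oneSubPow α z ∈ Complex.slitPlane := by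
  obtain ⟨h0, h1⟩ := hz
  have hw : (1 - z) ≠ 0 := by
    intro h
    have := congrArg Complex.re h
    simp at this
    linarith
  by_cases him : z.im = 0
  · have hzr : z = (z.re : ℂ) := Complex.ext (by simp) (by simp [him])
    rw [hzr, oneSubPow_ofReal h1.le, Complex.ofReal_mem_slitPlane]
    exact one_sub_rpow_pos hα.1 ⟨h0, h1⟩
  · rw [Complex.mem_slitPlane_iff]
    right
    have harg : |(1 - z).arg| < Real.pi / 2 :=
      Complex.abs_arg_lt_pi_div_two_iff.2 (Or.inl (by simpa using h1))
    have harg0 : (1 - z).arg ≠ 0 := by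
      intro h
      have := (Complex.arg_eq_zero_iff.1 h).2
      simp at this
      exact him this
    have hsin : Real.sin ((1 - z).arg * α) ≠ 0 := by
      have hab := abs_lt.1 harg
      have hpi := Real.pi_pos
      have hα0 := hα.1
      have hα1 := hα.2
      intro h
      have := (Real.sin_eq_zero_iff_of_lt_of_lt (by nlinarith) (by nlinarith)).1 h
      rcases mul_eq_zero.1 this with h | h
      · exact harg0 h
      · linarith
    rw [oneSubPow, Complex.cpow_def_of_ne_zero hw, Complex.sub_im, Complex.exp_im]
    have : (Complex.log (1 - z) * (α : ℂ)).im = (1 - z).arg * α := by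
      simp [Complex.log_im]
    rw [this]
    have := (Real.exp_pos (Complex.log (1 - z) * (α : ℂ)).re).ne'
    simp [hsin]

theorem hasDerivAt_oneSubPow (α : ℝ) {z : ℂ} (hz : z.re < 1) :
    HasDerivAt (oneSubPow α) ((α : ℂ) * (1 - z) ^ ((α : ℂ) - 1)) z := by
  have h := (((hasDerivAt_id z).const_sub 1).cpow_const (c := (α : ℂ))
    (Or.inl (by simpa using hz))).const_sub 1
  exact h.congr_deriv (by simp)

/-- On vertical lines in the strip, `|(1 - (1 - z) ^ α) / z|` is maximal on the real axis. -/
theorem norm_oneSubPow_le {α : ℝ} (hα : α ∈ Set.Ioo (0 : ℝ) 1) {z : ℂ}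
    (hz : z ∈ unitStrip) :
    ‖oneSubPow α z‖ ≤ (1 - (1 - z.re) ^ α) / z.re * ‖z‖ := by
  obtain ⟨h0, h1⟩ := hz
  have hlt : ∀ s ∈ Set.Icc (0 : ℝ) 1, s * z.re < 1 := fun s hs => by nlinarith [hs.1, hs.2]
  have hF : ∀ s ∈ Set.Icc (0 : ℝ) 1, HasDerivAt (fun s : ℝ => oneSubPow α (s * z))
      ((α : ℂ) * (1 - s * z) ^ ((α : ℂ) - 1) * z) s := fun s hs => by
    have hmul : HasDerivAt (fun w : ℂ => w * z) z (s : ℂ) := by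
      simpa using (hasDerivAt_id (s : ℂ)).mul_const z
    exact (HasDerivAt.comp (s : ℂ) (hasDerivAt_oneSubPow α (z := s * z)
      (by simpa using hlt s hs)) hmul).comp_ofReal
  have hB : ∀ s ∈ Set.Icc (0 : ℝ) 1,
      HasDerivAt (fun s : ℝ => (1 - (1 - s * z.re) ^ α) / z.re * ‖z‖)
      (α * (1 - s * z.re) ^ (α - 1) * ‖z‖) s := fun s hs => by
    have hmul : HasDerivAt (fun w : ℝ => 1 - w * z.re) (-z.re) s := by
      simpa using ((hasDerivAt_id s).mul_const z.re).const_sub 1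
    have h := (((hmul.rpow_const (p := α)
      (Or.inl (by linarith [hlt s hs]))).const_sub 1).div_const z.re).mul_const ‖z‖
    exact h.congr_deriv (by field_simp)
  have key := image_norm_le_of_norm_deriv_right_le_deriv_boundary'
    (fun s hs => (hF s hs).continuousAt.continuousWithinAt)
    (fun s hs => (hF s ⟨hs.1, hs.2.le⟩).hasDerivWithinAt) (by simp [oneSubPow])
    (fun s hs => (hB s hs).continuousAt.continuousWithinAt)
    (fun s hs => (hB s ⟨hs.1, hs.2.le⟩).hasDerivWithinAt)
    (fun s hs => ?_) (Set.right_mem_Icc.2 zero_le_one)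
  · simpa using key
  · have hs1 := hlt s ⟨hs.1, hs.2.le⟩
    rw [norm_mul, norm_mul, Complex.norm_real, Real.norm_of_nonneg hα.1.le]
    have hcast : ((α : ℂ) - 1) = ((α - 1 : ℝ) : ℂ) := by push_cast; rfl
    rw [hcast, Complex.norm_cpow_real]
    have hre : 1 - s * z.re ≤ ‖1 - (s : ℂ) * z‖ := by
      have := Complex.re_le_norm (1 - (s : ℂ) * z)
      simpa using this
    have hα0 := hα.1
    have hpow : ‖1 - (s : ℂ) * z‖ ^ (α - 1) ≤ (1 - s * z.re) ^ (α - 1) :=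
      Real.rpow_le_rpow_of_nonpos (sub_pos.2 hs1) hre (by linarith [hα.2])
    gcongr

theorem norm_le_mul_pow_succ_of_hasDerivAt {g g' : ℂ → ℂ} {δ M : ℝ} {j : ℕ} (hM : 0 ≤ M)
    (hg : ∀ s, ‖s‖ ≤ δ → HasDerivAt g (g' s) s) (h0 : g 0 = 0)
    (hb : ∀ s, ‖s‖ ≤ δ → ‖g' s‖ ≤ M * ‖s‖ ^ j) :
    ∀ s, ‖s‖ ≤ δ → ‖g s‖ ≤ M * ‖s‖ ^ (j + 1) := by
  intro s hs
  have key := Convex.norm_image_sub_le_of_norm_hasDerivWithin_le (f := g) (f' := g')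
    (s := Metric.closedBall (0 : ℂ) ‖s‖) (x := 0) (y := s) (C := M * ‖s‖ ^ j)
    (fun w hw => (hg w ((mem_closedBall_zero_iff.1 hw).trans hs)).hasDerivWithinAt)
    (fun w hw => (hb w ((mem_closedBall_zero_iff.1 hw).trans hs)).trans (by
      have := mem_closedBall_zero_iff.1 hw
      gcongr))
    (convex_closedBall _ _) (by simp) (by simp)
  rw [h0, sub_zero, sub_zero] at key
  rwa [pow_succ, ← mul_assoc]

/-- Third-order Taylor expansion of a holomorphic function, uniform over a compact set. -/
theorem exists_taylor_bound {f : ℂ → ℂ} {S K : Set ℂ} (hS : IsOpen S)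
    (hf : DifferentiableOn ℂ f S) (hK : IsCompact K) (hKS : K ⊆ S) :
    ∃ δ > (0 : ℝ), ∃ M > (0 : ℝ), ∀ c ∈ K, ‖deriv (deriv f) c‖ ≤ M ∧
      ‖deriv (deriv (deriv f)) c‖ ≤ M ∧ ∀ s, ‖s‖ ≤ δ →
        ‖f (c + s) - (f c + deriv f c * s + deriv (deriv f) c / 2 * s ^ 2 +
          deriv (deriv (deriv f)) c / 6 * s ^ 3)‖ ≤ M * ‖s‖ ^ 4 := by
  obtain ⟨δ, hδ, hδS⟩ := hK.exists_cthickening_subset_open hS hKS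
  have hKδ := hK.cthickening (r := δ)
  have hf1 := hf.deriv hS
  have hf2 := hf1.deriv hS
  have hf3 := hf2.deriv hS
  have hf4 := hf3.deriv hS
  obtain ⟨M2, hM2⟩ := hKδ.exists_bound_of_continuousOn (hf2.continuousOn.mono hδS)
  obtain ⟨M3, hM3⟩ := hKδ.exists_bound_of_continuousOn (hf3.continuousOn.mono hδS)
  obtain ⟨M4, hM4⟩ := hKδ.exists_bound_of_continuousOn (hf4.continuousOn.mono hδS)
  set M := 1 + |M2| + |M3| + |M4|
  have a2 := abs_nonneg M2
  have a3 := abs_nonneg M3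
  have a4 := abs_nonneg M4
  have hM : 0 < M := by positivity
  refine ⟨δ, hδ, M, hM, fun c hc => ?_⟩
  have hcδ : c ∈ Metric.cthickening δ K := Metric.self_subset_cthickening K hc
  refine ⟨(hM2 c hcδ).trans (by linarith [le_abs_self M2]),
    (hM3 c hcδ).trans (by linarith [le_abs_self M3]), ?_⟩
  have hmem : ∀ s, ‖s‖ ≤ δ → c + s ∈ Metric.cthickening δ K := fun s hs =>
    Metric.mem_cthickening_of_dist_le (c + s) c δ K hc (by simpa [dist_eq_norm] using hs)
  have hder : ∀ {g : ℂ → ℂ}, DifferentiableOn ℂ g S → ∀ s, ‖s‖ ≤ δ →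
      HasDerivAt (fun s => g (c + s)) (deriv g (c + s)) s := fun hg s hs =>
    ((hg.differentiableAt (hS.mem_nhds (hδS (hmem s hs)))).hasDerivAt).comp_const_add c s
  have hpow : ∀ (m : ℕ) (s : ℂ), HasDerivAt (fun s : ℂ => s ^ m) (m * s ^ (m - 1)) s :=
    fun m s => hasDerivAt_pow m s
  have b3 := norm_le_mul_pow_succ_of_hasDerivAt (j := 0) hM.le
    (fun s hs => (hder hf3 s hs).sub_const (deriv (deriv (deriv f)) c)) (by simp)
    (fun s hs => by
      rw [pow_zero, mul_one]
      exact (hM4 _ (hmem s hs)).trans (by linarith [le_abs_self M4]))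
  have b2 := norm_le_mul_pow_succ_of_hasDerivAt (j := 1) hM.le
    (g := fun s => deriv (deriv f) (c + s) -
      (deriv (deriv f) c + deriv (deriv (deriv f)) c * s))
    (fun s hs => (hder hf2 s hs).sub
      (((hasDerivAt_id s).const_mul (deriv (deriv (deriv f)) c)).const_add _)) (by simp)
    (fun s hs => by simpa using b3 s hs)
  have b1 := norm_le_mul_pow_succ_of_hasDerivAt (j := 2) hM.le
    (g := fun s => deriv f (c + s) - (deriv f c + deriv (deriv f) c * s +
      deriv (deriv (deriv f)) c / 2 * s ^ 2))
    (fun s hs => (hder hf1 s hs).sub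
      ((((hasDerivAt_id s).const_mul (deriv (deriv f) c)).const_add _).add
        ((hpow 2 s).const_mul (deriv (deriv (deriv f)) c / 2)))) (by simp)
    (fun s hs => by
      convert b2 s hs using 2
      push_cast
      ring)
  exact norm_le_mul_pow_succ_of_hasDerivAt (j := 3) hM.le
    (g := fun s => f (c + s) - (f c + deriv f c * s + deriv (deriv f) c / 2 * s ^ 2 +
          deriv (deriv (deriv f)) c / 6 * s ^ 3))
    (fun s hs => (hder hf s hs).sub
      (((((hasDerivAt_id s).const_mul (deriv f c)).const_add _).add
        ((hpow 2 s).const_mul (deriv (deriv f) c / 2))).add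
        ((hpow 3 s).const_mul (deriv (deriv (deriv f)) c / 6)))) (by simp)
    (fun s hs => by
      convert b1 s hs using 2
      push_cast
      ring)

/-- At real points, the derivative of a holomorphic extension is the real derivative. -/
theorem deriv_ofReal_eq_of_eqOn {f : ℂ → ℂ} {g : ℝ → ℝ} {U : Set ℝ} (hU : IsOpen U)
    (hf : ∀ y ∈ U, DifferentiableAt ℂ f y) (hfg : ∀ y ∈ U, f y = g y) :
    ∀ y ∈ U, deriv f y = ((deriv g y : ℝ) : ℂ) := by
  intro y hy
  have hd := (hf y hy).hasDerivAt
  have hev : (fun x : ℝ => (f x).re) =ᶠ[nhds y] g := by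
    filter_upwards [hU.mem_nhds hy] with x hx
    simp [hfg x hx]
  have hg : HasDerivAt g (deriv f y).re y := hd.real_of_complex.congr_of_eventuallyEq hev.symm
  have hev' : (fun x : ℝ => f x) =ᶠ[nhds y] fun x => (g x : ℂ) := by
    filter_upwards [hU.mem_nhds hy] with x hx using hfg x hx
  have h1 := hd.comp_ofReal.congr_of_eventuallyEq hev'.symm
  rw [hg.deriv]
  exact h1.unique hg.ofReal_comp


theorem exists_add_sq_add_cube_le_exp {β : ℝ} (hβ : 0 < β) :
    ∃ C > (0 : ℝ), ∀ y : ℝ, 0 ≤ y → y + y ^ 2 + y ^ 3 ≤ C * Real.exp (β * y) := by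
  refine ⟨1 / β + 2 / β ^ 2 + 6 / β ^ 3, by positivity, fun y hy => ?_⟩
  have key : ∀ j : ℕ, y ^ j ≤ j.factorial / β ^ j * Real.exp (β * y) := fun j => by
    have h := Real.pow_div_factorial_le_exp (β * y) (by positivity) j
    have hj : (0 : ℝ) < j.factorial := by positivity
    rw [div_le_iff₀ hj, mul_pow] at h
    rw [div_mul_eq_mul_div, le_div_iff₀ (by positivity)]
    linarith
  have h1 := key 1
  have h2 := key 2
  have h3 := key 3
  norm_num [Nat.factorial] at h1 h2 h3
  rw [add_mul, add_mul, one_div]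
  linarith

/-- Pointwise comparison of the integrand with a Gaussian near the saddle point. -/
theorem exists_local_gaussian_bound {lam0 M c0 : ℝ} (hM : 0 < M)
    (hc0 : 0 < c0) :
    ∃ C > (0 : ℝ), ∀ (N lam c t : ℝ) (κ R : ℂ), 0 ≤ N → lam0 ≤ lam → c0 ≤ c → |t| ≤ 1 →
      2 * M * |t| ≤ lam0 / 4 → ‖κ‖ ≤ M → ‖R‖ ≤ M * t ^ 4 →
      ‖Complex.exp (N * (-(lam * t ^ 2 / 2) + κ * t ^ 3 + R)) * (c / (c + t * Complex.I)) -
        Complex.exp (-(N * lam / 2 * t ^ 2)) * (1 + N * κ * t ^ 3 + -(Complex.I / c) * t)‖ ≤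
      C * (t ^ 2 + N * t ^ 4 + N ^ 2 * t ^ 6) * Real.exp (-(N * (lam0 / 4) * t ^ 2)) := by
  refine ⟨4 * M ^ 2 + M + 2 * M / c0 + 1 / c0 ^ 2, by positivity, ?_⟩
  intro N lam c t κ R hN hlam hc ht1 ht hκ hR
  have hcpos : 0 < c := hc0.trans_le hc
  set w : ℂ := N * (κ * t ^ 3 + R) with hw
  set z : ℂ := c + t * Complex.I with hz
  have hzre : z.re = c := by simp [hz]
  have hznorm : c ≤ ‖z‖ := by simpa [hzre] using Complex.re_le_norm z
  have hz0 : z ≠ 0 := by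
    intro h
    rw [h, norm_zero] at hznorm
    linarith
  have hc0' : (c : ℂ) ≠ 0 := by exact_mod_cast hcpos.ne'
  set E : ℂ := (c / z) - (1 + -(Complex.I / c) * t) with hE
  have hEeq : E = -(t : ℂ) ^ 2 / (c * z) := by
    rw [hE]
    field_simp
    rw [hz]
    ring_nf
    simp [Complex.I_sq]
  have hEn : ‖E‖ ≤ 1 / c0 ^ 2 * t ^ 2 := by
    rw [hEeq, norm_div, norm_neg, norm_pow, norm_mul, Complex.norm_real, Complex.norm_real,
      Real.norm_eq_abs, sq_abs, Real.norm_of_nonneg hcpos.le, div_mul_eq_mul_div, one_mul]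
    have : c0 ^ 2 ≤ c * ‖z‖ := by nlinarith
    gcongr
  have ht3 : |t| ^ 3 = |t| * t ^ 2 := by rw [← sq_abs t]; ring
  have ht4 : t ^ 4 ≤ |t| ^ 3 := by
    have : t ^ 4 = |t| ^ 3 * |t| := by rw [← pow_succ]; exact (Even.pow_abs (by decide) t).symm
    rw [this]
    exact mul_le_of_le_one_right (by positivity) ht1
  have hwn : ‖w‖ ≤ N * (2 * M * |t| ^ 3) := by
    rw [hw, norm_mul, Complex.norm_real, Real.norm_of_nonneg hN]
    gcongr
    refine (norm_add_le _ _).trans ?_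
    rw [norm_mul, norm_pow, Complex.norm_real, Real.norm_eq_abs]
    have h1 : ‖κ‖ * |t| ^ 3 ≤ M * |t| ^ 3 := by gcongr
    have h2 : M * t ^ 4 ≤ M * |t| ^ 3 := by gcongr
    linarith
  have hwe : ‖w‖ ≤ N * (lam0 / 4) * t ^ 2 := by
    refine hwn.trans ?_
    have h : 2 * M * |t| * t ^ 2 ≤ lam0 / 4 * t ^ 2 := by gcongr
    rw [ht3, mul_assoc N, ← mul_assoc (2 * M)]
    exact mul_le_mul_of_nonneg_left h hN
  set e := Real.exp ‖w‖ with he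
  have he1 : 1 ≤ e := Real.one_le_exp (norm_nonneg _)
  have hexp0 : ‖Complex.exp w‖ ≤ e := by
    simpa using Complex.norm_exp_sub_sum_le_norm_mul_exp w 0
  have hexp1 : ‖Complex.exp w - 1‖ ≤ ‖w‖ * e := by
    simpa using Complex.norm_exp_sub_sum_le_norm_mul_exp w 1
  have hexp2 : ‖Complex.exp w - (1 + w)‖ ≤ ‖w‖ ^ 2 * e := by
    simpa [Finset.sum_range_succ] using Complex.norm_exp_sub_sum_le_norm_mul_exp w 2
  have hsplit : Complex.exp (N * (-(lam * t ^ 2 / 2) + κ * t ^ 3 + R)) =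
      Complex.exp (-(N * lam / 2 * t ^ 2)) * Complex.exp w := by
    rw [← Complex.exp_add, hw]
    ring_nf
  have hdecomp : Complex.exp (-(N * lam / 2 * t ^ 2)) * Complex.exp w * (c / z) -
      Complex.exp (-(N * lam / 2 * t ^ 2)) * (1 + N * κ * t ^ 3 + -(Complex.I / c) * t) =
      Complex.exp (-(N * lam / 2 * t ^ 2)) * ((Complex.exp w - (1 + w)) + N * R +
        -(Complex.I / c) * t * (Complex.exp w - 1) + E * Complex.exp w) := by
    rw [hE, hw]
    ring
  have hgauss : ‖Complex.exp (-(N * lam / 2 * t ^ 2))‖ = Real.exp (-(N * lam / 2 * t ^ 2)) := by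
    rw [Complex.norm_exp]
    congr 1
    norm_cast
  have hb1 : ‖w‖ ^ 2 * e ≤ 4 * M ^ 2 * (N ^ 2 * t ^ 6) * e := by
    have : (N * (2 * M * |t| ^ 3)) ^ 2 = 4 * M ^ 2 * (N ^ 2 * t ^ 6) := by
      have h6 : (|t| ^ 3) ^ 2 = t ^ 6 := by
        rw [← pow_mul]; exact Even.pow_abs (by decide) t
      rw [← h6]; ring
    rw [← this]
    gcongr
  have hb2 : ‖(N : ℂ) * R‖ ≤ M * (N * t ^ 4) * e := by
    rw [norm_mul, Complex.norm_real, Real.norm_of_nonneg hN]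
    calc N * ‖R‖ ≤ N * (M * t ^ 4) := by gcongr
      _ = M * (N * t ^ 4) * 1 := by ring
      _ ≤ _ := by gcongr
  have hb3 : ‖-(Complex.I / c) * t * (Complex.exp w - 1)‖ ≤ 2 * M / c0 * (N * t ^ 4) * e := by
    rw [norm_mul, norm_mul, norm_neg, norm_div, Complex.norm_I, Complex.norm_real,
      Complex.norm_real, Real.norm_eq_abs, Real.norm_eq_abs, abs_of_pos hcpos]
    calc 1 / c * |t| * ‖Complex.exp w - 1‖
        ≤ 1 / c0 * |t| * (N * (2 * M * |t| ^ 3) * e) := by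
          have := hexp1.trans (mul_le_mul_of_nonneg_right hwn (zero_le_one.trans he1))
          gcongr
      _ = 2 * M / c0 * (N * |t| ^ 4) * e := by ring
      _ = _ := by rw [Even.pow_abs (by decide) t]
  have hb4 : ‖E * Complex.exp w‖ ≤ 1 / c0 ^ 2 * t ^ 2 * e := by
    rw [norm_mul]
    gcongr
  rw [hsplit, hdecomp, norm_mul, hgauss]
  have htot : ‖(Complex.exp w - (1 + w)) + N * R +
        -(Complex.I / c) * t * (Complex.exp w - 1) + E * Complex.exp w‖ ≤
      (4 * M ^ 2 + M + 2 * M / c0 + 1 / c0 ^ 2) * (t ^ 2 + N * t ^ 4 + N ^ 2 * t ^ 6) * e := by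
    calc _ ≤ 4 * M ^ 2 * (N ^ 2 * t ^ 6) * e + M * (N * t ^ 4) * e +
          2 * M / c0 * (N * t ^ 4) * e + 1 / c0 ^ 2 * t ^ 2 * e :=
          (norm_add_le _ _).trans (add_le_add ((norm_add_le _ _).trans
            (add_le_add ((norm_add_le _ _).trans (add_le_add (hexp2.trans hb1) hb2)) hb3)) hb4)
      _ = (4 * M ^ 2 * (N ^ 2 * t ^ 6) + M * (N * t ^ 4) +
          2 * M / c0 * (N * t ^ 4) + 1 / c0 ^ 2 * t ^ 2) * e := by ring
      _ ≤ _ := by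
        have p1 : 0 ≤ 4 * M ^ 2 * (t ^ 2 + N * t ^ 4) := by positivity
        have p2 : 0 ≤ M * (t ^ 2 + N ^ 2 * t ^ 6) := by positivity
        have p3 : 0 ≤ 2 * M / c0 * (t ^ 2 + N ^ 2 * t ^ 6) := by positivity
        have p4 : 0 ≤ 1 / c0 ^ 2 * (N * t ^ 4 + N ^ 2 * t ^ 6) := by positivity
        gcongr
        linarith
  calc _ ≤ Real.exp (-(N * lam / 2 * t ^ 2)) *
        ((4 * M ^ 2 + M + 2 * M / c0 + 1 / c0 ^ 2) * (t ^ 2 + N * t ^ 4 + N ^ 2 * t ^ 6) * e) := by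
        gcongr
    _ = (4 * M ^ 2 + M + 2 * M / c0 + 1 / c0 ^ 2) * (t ^ 2 + N * t ^ 4 + N ^ 2 * t ^ 6) *
        Real.exp (-(N * lam / 2 * t ^ 2) + ‖w‖) := by
        rw [Real.exp_add]; ring
    _ ≤ _ := by
        have : N * t ^ 2 * lam0 ≤ N * t ^ 2 * lam := by gcongr
        gcongr
        linarith

/-- The Gaussian tail is dominated by the same expression as the local error. -/
theorem norm_gaussian_tail_le {lam0 M m δ N lam t : ℝ} {κ μ : ℂ} (hM : 0 ≤ M) (hm : 0 ≤ m)
    (hδ : 0 < δ) (hN : 0 ≤ N) (hlam0 : 0 ≤ lam0) (hlam : lam0 ≤ lam) (ht : δ ≤ |t|)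
    (hκ : ‖κ‖ ≤ M) (hμ : ‖μ‖ ≤ m) :
    ‖Complex.exp (-(N * lam / 2 * t ^ 2)) * (1 + N * κ * t ^ 3 + μ * t)‖ ≤
      (1 / δ ^ 2 + M / δ + m / δ) * (t ^ 2 + N * t ^ 4 + N ^ 2 * t ^ 6) *
        Real.exp (-(N * (lam0 / 4) * t ^ 2)) := by
  have hgauss : ‖Complex.exp (-(N * lam / 2 * t ^ 2))‖ = Real.exp (-(N * lam / 2 * t ^ 2)) := by
    rw [Complex.norm_exp]
    congr 1
    norm_cast
  rw [norm_mul, hgauss, mul_comm]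
  have hexp : Real.exp (-(N * lam / 2 * t ^ 2)) ≤ Real.exp (-(N * (lam0 / 4) * t ^ 2)) := by
    have h1 : N * t ^ 2 * lam0 ≤ N * t ^ 2 * lam := by gcongr
    have h2 : 0 ≤ N * t ^ 2 * lam0 := by positivity
    rw [Real.exp_le_exp]
    linarith
  have h1 : 1 ≤ 1 / δ ^ 2 * t ^ 2 := by
    rw [div_mul_eq_mul_div, one_mul, le_div_iff₀ (by positivity), one_mul, ← sq_abs t]
    gcongr
  have hdiv : 1 ≤ |t| / δ := by rwa [le_div_iff₀ hδ, one_mul]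
  have h2 : ‖(N : ℂ) * κ * t ^ 3‖ ≤ M / δ * (N * t ^ 4) := by
    rw [norm_mul, norm_mul, norm_pow, Complex.norm_real, Complex.norm_real,
      Real.norm_of_nonneg hN, Real.norm_eq_abs]
    calc N * ‖κ‖ * |t| ^ 3 ≤ N * M * |t| ^ 3 * 1 := by rw [mul_one]; gcongr
      _ ≤ N * M * |t| ^ 3 * (|t| / δ) := by gcongr
      _ = M / δ * (N * |t| ^ 4) := by ring
      _ = _ := by rw [Even.pow_abs (by decide) t]
  have h3 : ‖μ * t‖ ≤ m / δ * t ^ 2 := by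
    rw [norm_mul, Complex.norm_real, Real.norm_eq_abs]
    calc ‖μ‖ * |t| ≤ m * |t| * 1 := by rw [mul_one]; gcongr
      _ ≤ m * |t| * (|t| / δ) := by gcongr
      _ = m / δ * |t| ^ 2 := by ring
      _ = _ := by rw [sq_abs]
  have htot : ‖1 + N * κ * t ^ 3 + μ * t‖ ≤
      (1 / δ ^ 2 + M / δ + m / δ) * (t ^ 2 + N * t ^ 4 + N ^ 2 * t ^ 6) := by
    have hn : ‖1 + N * κ * t ^ 3 + μ * t‖ ≤
        1 / δ ^ 2 * t ^ 2 + M / δ * (N * t ^ 4) + m / δ * t ^ 2 :=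
      (norm_add_le _ _).trans (add_le_add ((norm_add_le _ _).trans
        (add_le_add (by simpa using h1) h2)) h3)
    have p1 : 0 ≤ 1 / δ ^ 2 * (N * t ^ 4 + N ^ 2 * t ^ 6) := by positivity
    have p2 : 0 ≤ M / δ * (t ^ 2 + N ^ 2 * t ^ 6) := by positivity
    have p3 : 0 ≤ m / δ * (N * t ^ 4 + N ^ 2 * t ^ 6) := by positivity
    linarith
  gcongr

theorem integrable_pow_mul_exp_neg_mul_sq {b : ℝ} (hb : 0 < b) (j : ℕ) :
    Integrable fun t : ℝ => t ^ j * Real.exp (-b * t ^ 2) := by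
  simpa using integrable_rpow_mul_exp_neg_mul_sq hb (s := j)
    (by linarith [(Nat.cast_nonneg j : (0 : ℝ) ≤ j)])

theorem integral_gaussian_mul_one_add_odd {b : ℝ} (hb : 0 < b) (κ μ : ℂ) :
    Integrable (fun t : ℝ => Complex.exp (-(b * t ^ 2)) * (1 + κ * t ^ 3 + μ * t)) ∧
    ∫ t : ℝ, Complex.exp (-(b * t ^ 2)) * (1 + κ * t ^ 3 + μ * t) =
      ((√(Real.pi / b) : ℝ) : ℂ) := by
  have hfun : (fun t : ℝ => Complex.exp (-(b * t ^ 2)) * (1 + κ * t ^ 3 + μ * t)) =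
      fun t : ℝ => ((Real.exp (-b * t ^ 2) : ℝ) : ℂ) +
        (κ * ((t ^ 3 * Real.exp (-b * t ^ 2) : ℝ) : ℂ) +
          μ * ((t ^ 1 * Real.exp (-b * t ^ 2) : ℝ) : ℂ)) := by
    funext t
    push_cast
    ring_nf
  have hI0 : Integrable fun t : ℝ => ((Real.exp (-b * t ^ 2) : ℝ) : ℂ) :=
    (integrable_exp_neg_mul_sq hb).ofReal
  have hI3 : Integrable fun t : ℝ => κ * ((t ^ 3 * Real.exp (-b * t ^ 2) : ℝ) : ℂ) :=
    (integrable_pow_mul_exp_neg_mul_sq hb 3).ofReal.const_mul κ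
  have hI1 : Integrable fun t : ℝ => μ * ((t ^ 1 * Real.exp (-b * t ^ 2) : ℝ) : ℂ) :=
    (integrable_pow_mul_exp_neg_mul_sq hb 1).ofReal.const_mul μ
  have hodd : ∀ j : ℕ, Odd j → ∫ t : ℝ, t ^ j * Real.exp (-b * t ^ 2) = 0 := fun j hj => by
    have h := integral_neg_eq_self (fun t : ℝ => t ^ j * Real.exp (-b * t ^ 2)) volume
    simp only [hj.neg_pow, neg_sq, neg_mul, integral_neg] at h
    simp only [neg_mul]
    linarith
  rw [hfun]
  have hI31 : Integrable fun t : ℝ => κ * ((t ^ 3 * Real.exp (-b * t ^ 2) : ℝ) : ℂ) +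
      μ * ((t ^ 1 * Real.exp (-b * t ^ 2) : ℝ) : ℂ) := hI3.add hI1
  refine ⟨hI0.add hI31, ?_⟩
  rw [integral_add hI0 hI31, integral_add hI3 hI1, integral_const_mul,
    integral_const_mul, integral_complex_ofReal, integral_complex_ofReal,
    integral_complex_ofReal, hodd 3 (by decide), hodd 1 (by decide), integral_gaussian]
  simp

theorem norm_integral_sub_gaussian_le {β C₁ C₂ N lam : ℝ} (hβ : 0 < β) (hC₂ : 0 ≤ C₂) (hN : 1 ≤ N) (hlam : 0 < lam) {κ μ : ℂ} {q : ℝ → ℂ}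
    (hq : Continuous q)
    (hb : ∀ t : ℝ, ‖q t - Complex.exp (-(N * lam / 2 * t ^ 2)) *
      (1 + N * κ * t ^ 3 + μ * t)‖ ≤
      C₁ / N * Real.exp (-(N * β) * t ^ 2) + C₂ / N ^ 2 * (1 + t ^ 2)⁻¹) :
    ‖(∫ t, q t) - ((√(2 * Real.pi / (N * lam)) : ℝ) : ℂ)‖ ≤
      (C₁ * √(Real.pi / β) + C₂ * Real.pi) / (N * √N) := by
  have hN0 : 0 < N := by linarith
  obtain ⟨hgi, hg⟩ := integral_gaussian_mul_one_add_odd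
    (b := N * lam / 2) (by positivity) (N * κ) μ
  push_cast at hgi hg
  have hmaj : Integrable fun t : ℝ =>
      C₁ / N * Real.exp (-(N * β) * t ^ 2) + C₂ / N ^ 2 * (1 + t ^ 2)⁻¹ :=
    ((integrable_exp_neg_mul_sq (by positivity)).const_mul _).add
      (integrable_inv_one_add_sq.const_mul _)
  have hdi : Integrable fun t : ℝ => q t - Complex.exp (-(N * lam / 2 * t ^ 2)) *
      (1 + N * κ * t ^ 3 + μ * t) :=
    hmaj.mono' (by
      refine Continuous.aestronglyMeasurable ?_
      fun_prop) (Filter.Eventually.of_forall hb)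
  have hqi : Integrable q := by
    have := hdi.add hgi
    refine this.congr (Filter.Eventually.of_forall fun t => ?_)
    simp
  have harg : Real.pi / (N * lam / 2) = 2 * Real.pi / (N * lam) := by field_simp
  rw [← harg, ← hg, ← integral_sub hqi hgi]
  refine (norm_integral_le_of_norm_le hmaj (Filter.Eventually.of_forall hb)).trans ?_
  rw [integral_add ((integrable_exp_neg_mul_sq (by positivity)).const_mul _)
    (integrable_inv_one_add_sq.const_mul _), integral_const_mul, integral_const_mul,
    integral_gaussian, integral_univ_inv_one_add_sq, add_div]
  have hs : √(Real.pi / (N * β)) = √(Real.pi / β) / √N := by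
    rw [← Real.sqrt_div' _ hN0.le]
    congr 1
    field_simp
  have hsN : √N ≤ N := by
    rw [Real.sqrt_le_left hN0.le]
    nlinarith
  have hsN0 : 0 < √N := Real.sqrt_pos.2 hN0
  refine add_le_add (le_of_eq ?_) ?_
  · rw [hs]
    field_simp
  · rw [div_mul_eq_mul_div]
    have := Real.pi_pos
    gcongr
    nlinarith

theorem deriv_hfun {α x c : ℝ} (hα : 0 < α) (hc : c ∈ Set.Ioo (0 : ℝ) 1) :
    deriv (hfun α x) c = 1 / c - x * (α * (1 - c) ^ (α - 1) / (1 - (1 - c) ^ α)) := by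
  have hmul : HasDerivAt (fun w : ℝ => 1 - w) (-1) c := by
    simpa using (hasDerivAt_id c).const_sub 1
  have hF := (hmul.rpow_const (p := α) (Or.inl (by linarith [hc.2]))).const_sub 1
  have hlog := ((hF.log (one_sub_rpow_pos hα hc).ne').const_mul x)
  have h := (Real.hasDerivAt_log hc.1.ne').sub hlog
  have h' : HasDerivAt (hfun α x)
      (1 / c - x * (α * (1 - c) ^ (α - 1) / (1 - (1 - c) ^ α))) c :=
    h.congr_deriv (by simp)
  exact h'.deriv

/-- The saddle points stay in a compact subinterval of `(0, 1)`. -/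
theorem exists_saddle_mem_Icc {α a b : ℝ} (hα : α ∈ Set.Ioo (0 : ℝ) 1) (ha : 0 < a)
    (hb : b < 1) :
    ∃ lo hi : ℝ, 0 < lo ∧ hi < 1 ∧ ∀ x ∈ Set.Icc a b, ∀ c ∈ Set.Ioo (0 : ℝ) 1,
      deriv (hfun α x) c = 0 → c ∈ Set.Icc lo hi := by
  obtain ⟨hα0, hα1⟩ := hα
  have hs : 0 < 1 - α := by linarith
  refine ⟨1 - (max b 0) ^ (1 - α)⁻¹, 1 - (a * α) ^ (1 - α)⁻¹, ?_, ?_, ?_⟩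
  · have := Real.rpow_lt_one (le_max_right b 0) (max_lt hb zero_lt_one) (inv_pos.2 hs)
    linarith
  · have := Real.rpow_pos_of_pos (mul_pos ha hα0) (1 - α)⁻¹
    linarith
  · intro x hx c hc hd
    rw [deriv_hfun hα0 hc] at hd
    obtain ⟨hc0, hc1⟩ := hc
    have hu : 0 < 1 - c := by linarith
    have hFpos := one_sub_rpow_pos hα0 ⟨hc0, hc1⟩
    have hv : 0 < (1 - c) ^ (1 - α) := Real.rpow_pos_of_pos hu _
    have hinv : (1 - c) ^ (α - 1) = ((1 - c) ^ (1 - α))⁻¹ := by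
      rw [← Real.rpow_neg hu.le]
      congr 1
      ring
    rw [hinv] at hd
    have heq : x * α * c = (1 - (1 - c) ^ α) * (1 - c) ^ (1 - α) := by
      field_simp at hd
      linarith
    have hup : 1 - (1 - c) ^ α ≤ c := by
      have := Real.rpow_le_rpow_of_exponent_ge hu (by linarith : 1 - c ≤ 1) hα1.le
      rw [Real.rpow_one] at this
      linarith
    have hlow : α * c ≤ 1 - (1 - c) ^ α := by
      have := rpow_one_add_le_one_add_mul_self (s := -c) (by linarith) hα0.le hα1.le
      rw [← sub_eq_add_neg] at this
      linarith
    have hroot : ∀ y : ℝ, 0 ≤ y → (y ^ (1 - α)) ^ (1 - α)⁻¹ = y := fun y hy => by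
      rw [← Real.rpow_mul hy, mul_inv_cancel₀ hs.ne', Real.rpow_one]
    have h1 : a * α ≤ (1 - c) ^ (1 - α) := by
      have h2 : x * α * c ≤ c * (1 - c) ^ (1 - α) := by rw [heq]; gcongr
      have h3 : x * α ≤ (1 - c) ^ (1 - α) := by
        rw [mul_comm] at h2
        exact le_of_mul_le_mul_left h2 hc0
      exact (mul_le_mul_of_nonneg_right hx.1 hα0.le).trans h3
    have h2 : (1 - c) ^ (1 - α) ≤ max b 0 := by
      have h3 : α * c * (1 - c) ^ (1 - α) ≤ α * c * x := by
        have : α * c * (1 - c) ^ (1 - α) ≤ x * α * c := by rw [heq]; gcongr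
        linarith
      exact (le_of_mul_le_mul_left h3 (by positivity)).trans (hx.2.trans (le_max_left _ _))
    constructor
    · have := Real.rpow_le_rpow hv.le h2 (inv_pos.2 hs).le
      rw [hroot _ hu.le] at this
      linarith
    · have := Real.rpow_le_rpow (by positivity) h1 (inv_pos.2 hs).le
      rw [hroot _ hu.le] at this
      linarith

theorem ofReal_mem_unitStrip {y : ℝ} (hy : y ∈ Set.Ioo (0 : ℝ) 1) : (y : ℂ) ∈ unitStrip := by
  simpa [unitStrip] using hy

theorem add_mul_I_mem_unitStrip {y : ℝ} (hy : y ∈ Set.Ioo (0 : ℝ) 1) (t : ℝ) :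
    (y : ℂ) + t * Complex.I ∈ unitStrip := by
  simpa [unitStrip] using hy

theorem differentiableOn_log_unitStrip : DifferentiableOn ℂ Complex.log unitStrip :=
  fun _ hz => (Complex.differentiableAt_log (Or.inl hz.1)).differentiableWithinAt

theorem differentiableOn_log_oneSubPow {α : ℝ} (hα : α ∈ Set.Ioo (0 : ℝ) 1) :
    DifferentiableOn ℂ (fun z => Complex.log (oneSubPow α z)) unitStrip := fun _ hz =>
  ((hasDerivAt_oneSubPow α hz.2).differentiableAt.clog
    (oneSubPow_mem_slitPlane hα hz)).differentiableWithinAt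

theorem deriv_sub_const_mul_eqOn {f g : ℂ → ℂ} {S : Set ℂ} (hS : IsOpen S)
    (hf : DifferentiableOn ℂ f S) (hg : DifferentiableOn ℂ g S) (x : ℂ) :
    Set.EqOn (deriv fun z => f z - x * g z) (fun z => deriv f z - x * deriv g z) S := by
  intro z hz
  have hf' := (hf.differentiableAt (hS.mem_nhds hz)).hasDerivAt
  have hg' := (hg.differentiableAt (hS.mem_nhds hz)).hasDerivAt
  exact (hf'.sub (hg'.const_mul x)).deriv

/-- The holomorphic extension of `hfun` has the same first two derivatives at real points. -/
theorem ofReal_deriv_hfun {α : ℝ} (hα : α ∈ Set.Ioo (0 : ℝ) 1) (x : ℝ) {c : ℝ}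
    (hc : c ∈ Set.Ioo (0 : ℝ) 1) :
    deriv Complex.log c - x * deriv (fun z => Complex.log (oneSubPow α z)) c =
        ((deriv (hfun α x) c : ℝ) : ℂ) ∧
    deriv (deriv Complex.log) c -
        x * deriv (deriv fun z => Complex.log (oneSubPow α z)) c =
        ((deriv (deriv (hfun α x)) c : ℝ) : ℂ) := by
  have hS := isOpen_unitStrip
  have hL := differentiableOn_log_oneSubPow hα
  have hl := differentiableOn_log_unitStrip
  have hΦ : DifferentiableOn ℂ
      (fun z => Complex.log z - x * Complex.log (oneSubPow α z)) unitStrip :=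
    hl.sub (hL.const_mul (x : ℂ))
  have hreal : ∀ y ∈ Set.Ioo (0 : ℝ) 1,
      Complex.log y - x * Complex.log (oneSubPow α y) = ((hfun α x y : ℝ) : ℂ) := by
    intro y hy
    rw [oneSubPow_ofReal hy.2.le, ← Complex.ofReal_log hy.1.le,
      ← Complex.ofReal_log (one_sub_rpow_pos hα.1 hy).le, hfun]
    push_cast
    rfl
  have h1 := deriv_ofReal_eq_of_eqOn isOpen_Ioo
    (fun y hy => hΦ.differentiableAt (hS.mem_nhds (ofReal_mem_unitStrip hy))) hreal
  have h2 := deriv_ofReal_eq_of_eqOn isOpen_Ioo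
    (fun y hy => (hΦ.deriv hS).differentiableAt (hS.mem_nhds (ofReal_mem_unitStrip hy))) h1
  have e1 := deriv_sub_const_mul_eqOn hS hl hL (x : ℂ)
  have hcS := ofReal_mem_unitStrip hc
  refine ⟨(e1 hcS).symm.trans (h1 c hc), ?_⟩
  rw [← h2 c hc, (e1.eventuallyEq_of_mem (hS.mem_nhds hcS)).deriv_eq]
  exact (deriv_sub_const_mul_eqOn hS (hl.deriv hS) (hL.deriv hS) (x : ℂ) hcS).symm

/-- Uniform expansion of the phase along the vertical line through the saddle point. -/
theorem exists_phase_expansion {α lo hi : ℝ} (hα : α ∈ Set.Ioo (0 : ℝ) 1) (hlo : 0 < lo)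
    (hhi : hi < 1) :
    ∃ δ > (0 : ℝ), ∃ M > (0 : ℝ), ∀ x ∈ Set.Icc (0 : ℝ) 1, ∀ c ∈ Set.Icc lo hi,
      deriv (hfun α x) c = 0 → |deriv (deriv (hfun α x)) c| ≤ M ∧
      ∃ κ : ℂ, ‖κ‖ ≤ M ∧ ∀ t : ℝ, |t| ≤ δ → ∃ R : ℂ, ‖R‖ ≤ M * t ^ 4 ∧
        x * (Complex.log (oneSubPow α (c + t * Complex.I)) - Complex.log (oneSubPow α c)) -
          (Complex.log (c + t * Complex.I) - Complex.log c) =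
        deriv (deriv (hfun α x)) c * t ^ 2 / 2 + κ * t ^ 3 + R := by
  have hK : IsCompact (Complex.ofReal '' Set.Icc lo hi) :=
    isCompact_Icc.image Complex.continuous_ofReal
  have hmem : ∀ c ∈ Set.Icc lo hi, c ∈ Set.Ioo (0 : ℝ) 1 := fun c hc =>
    ⟨hlo.trans_le hc.1, hc.2.trans_lt hhi⟩
  have hKS : Complex.ofReal '' Set.Icc lo hi ⊆ unitStrip := by
    rintro _ ⟨c, hc, rfl⟩
    exact ofReal_mem_unitStrip (hmem c hc)
  obtain ⟨δ₁, hδ₁, M₁, hM₁, H₁⟩ := exists_taylor_bound isOpen_unitStrip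
    (differentiableOn_log_oneSubPow hα) hK hKS
  obtain ⟨δ₂, hδ₂, M₂, hM₂, H₂⟩ := exists_taylor_bound isOpen_unitStrip
    differentiableOn_log_unitStrip hK hKS
  refine ⟨min δ₁ δ₂, lt_min hδ₁ hδ₂, M₁ + M₂, by positivity, ?_⟩
  intro x hx c hc hd
  obtain ⟨A2, A3, AT⟩ := H₁ c ⟨c, hc, rfl⟩
  obtain ⟨B2, B3, BT⟩ := H₂ c ⟨c, hc, rfl⟩
  obtain ⟨e1, e2⟩ := ofReal_deriv_hfun hα x (hmem c hc)
  set L : ℂ → ℂ := fun z => Complex.log (oneSubPow α z) with hL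
  have hxn : ‖(x : ℂ)‖ ≤ 1 := by
    rw [Complex.norm_real, Real.norm_of_nonneg hx.1]; exact hx.2
  have hcomb : ∀ (u v : ℂ) (U V : ℝ), ‖u‖ ≤ U → ‖v‖ ≤ V → ‖x * u - v‖ ≤ U + V := by
    intro u v U V hu hv
    refine (norm_sub_le _ _).trans (add_le_add ?_ hv)
    rw [norm_mul]
    exact (mul_le_of_le_one_left (norm_nonneg _) hxn).trans hu
  rw [hd, Complex.ofReal_zero, sub_eq_zero] at e1
  refine ⟨?_, -(x * deriv (deriv (deriv L)) c - deriv (deriv (deriv Complex.log)) c) / 6 *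
    Complex.I, ?_, fun t ht => ?_⟩
  · rw [← Real.norm_eq_abs, ← Complex.norm_real, ← e2, norm_sub_rev]
    exact hcomb _ _ _ _ A2 B2
  · rw [norm_mul, Complex.norm_I, mul_one, norm_div, norm_neg]
    have := hcomb _ _ _ _ A3 B3
    have h6 : ‖(6 : ℂ)‖ = 6 := by norm_num
    rw [h6, div_le_iff₀ (by norm_num)]
    linarith
  · have hs : ‖(t : ℂ) * Complex.I‖ = |t| := by simp
    have AT' := AT (t * Complex.I) (hs.trans_le (ht.trans (min_le_left _ _)))
    have BT' := BT (t * Complex.I) (hs.trans_le (ht.trans (min_le_right _ _)))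
    rw [hs, Even.pow_abs (by decide) t] at AT' BT'
    refine ⟨_, (hcomb _ _ _ _ AT' BT').trans_eq (by ring), ?_⟩
    rw [← e2, e1, mul_pow, mul_pow, Complex.I_sq, Complex.I_pow_three]
    simp only [hL]
    ring

/-- The vertical line is a path of descent: comparison of moduli with the real point. -/
theorem norm_oneSubPow_vertical_le {α c : ℝ} (hα : α ∈ Set.Ioo (0 : ℝ) 1)
    (hc : c ∈ Set.Ioo (0 : ℝ) 1) (t : ℝ) :
    ‖oneSubPow α (c + t * Complex.I)‖ ≤
      (1 - (1 - c) ^ α) / c * ‖(c : ℂ) + t * Complex.I‖ := by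
  simpa using norm_oneSubPow_le hα (add_mul_I_mem_unitStrip hc t)

theorem norm_add_mul_I_sq (c t : ℝ) : ‖(c : ℂ) + t * Complex.I‖ ^ 2 = c ^ 2 + t ^ 2 := by
  rw [Complex.sq_norm, Complex.normSq_add_mul_I]

theorem re_phase_le {α x c : ℝ} (hα : α ∈ Set.Ioo (0 : ℝ) 1) (hx : x ∈ Set.Icc (0 : ℝ) 1)
    (hc : c ∈ Set.Ioo (0 : ℝ) 1) (t : ℝ) :
    (x * (Complex.log (oneSubPow α (c + t * Complex.I)) - Complex.log (oneSubPow α c)) -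
      (Complex.log (c + t * Complex.I) - Complex.log c) : ℂ).re ≤
      -((1 - x) / 2 * (t ^ 2 / (c ^ 2 + t ^ 2))) := by
  have hc0 := hc.1
  have hFpos := one_sub_rpow_pos hα.1 hc
  have hFc : ‖oneSubPow α c‖ = 1 - (1 - c) ^ α := by
    rw [oneSubPow_ofReal hc.2.le, Complex.norm_real, Real.norm_of_nonneg hFpos.le]
  have hzn := norm_add_mul_I_sq c t
  have hznpos : 0 < ‖(c : ℂ) + t * Complex.I‖ := by
    refine norm_pos_iff.2 fun h => ?_
    rw [h] at hzn
    simp at hzn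
    nlinarith [sq_nonneg t]
  have hFz : 0 < ‖oneSubPow α (c + t * Complex.I)‖ :=
    norm_pos_iff.2 (Complex.slitPlane_ne_zero
      (oneSubPow_mem_slitPlane hα (add_mul_I_mem_unitStrip hc t)))
  have hlogF := Real.log_le_log hFz (norm_oneSubPow_vertical_le hα hc t)
  rw [Real.log_mul (by positivity) hznpos.ne', Real.log_div hFpos.ne' hc0.ne'] at hlogF
  have hlogz : t ^ 2 / (c ^ 2 + t ^ 2) ≤
      2 * (Real.log ‖(c : ℂ) + t * Complex.I‖ - Real.log c) := by
    have h1 : 2 * (Real.log ‖(c : ℂ) + t * Complex.I‖ - Real.log c) =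
        -Real.log (c ^ 2 / (c ^ 2 + t ^ 2)) := by
      rw [Real.log_div (by positivity) (by positivity), ← hzn, Real.log_pow, Real.log_pow]
      push_cast
      ring
    have h2 := Real.log_le_sub_one_of_pos (x := c ^ 2 / (c ^ 2 + t ^ 2)) (by positivity)
    have h3 : t ^ 2 / (c ^ 2 + t ^ 2) = 1 - c ^ 2 / (c ^ 2 + t ^ 2) := by
      field_simp
      ring
    rw [h1, h3]
    linarith
  rw [Complex.sub_re, Complex.re_ofReal_mul, Complex.sub_re, Complex.sub_re, Complex.log_re,
    Complex.log_re, Complex.log_re, Complex.log_re, hFc, Complex.norm_real,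
    Real.norm_of_nonneg hc0.le]
  have hA := mul_le_mul_of_nonneg_left hlogF hx.1
  have hB := mul_le_mul_of_nonneg_left hlogz (sub_nonneg.2 hx.2)
  linarith

theorem one_sub_le_of_phase_expansion {α x c δ M D : ℝ} {κ : ℂ}
    (hα : α ∈ Set.Ioo (0 : ℝ) 1) (hx : x ∈ Set.Icc (0 : ℝ) 1) (hc : c ∈ Set.Ioo (0 : ℝ) 1)
    (hδ : 0 < δ) (hκ : ‖κ‖ ≤ M)
    (hexp : ∀ t : ℝ, |t| ≤ δ → ∃ R : ℂ, ‖R‖ ≤ M * t ^ 4 ∧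
        x * (Complex.log (oneSubPow α (c + t * Complex.I)) - Complex.log (oneSubPow α c)) -
          (Complex.log (c + t * Complex.I) - Complex.log c) =
        D * t ^ 2 / 2 + κ * t ^ 3 + R) :
    1 - x ≤ -D := by
  have hc0 := hc.1
  have hpt : ∀ t ∈ Set.Ioc (0 : ℝ) δ,
      (1 - x) / (c ^ 2 + t ^ 2) - 2 * (M * t + M * t ^ 2) ≤ -D := by
    intro t ht
    have ht0 := ht.1
    obtain ⟨R, hR, he⟩ := hexp t (by rw [abs_of_pos ht.1]; exact ht.2)
    have h := re_phase_le hα hx hc t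
    rw [he] at h
    have hD : ((D : ℂ) * t ^ 2 / 2).re = D * t ^ 2 / 2 := by
      have : (D : ℂ) * t ^ 2 / 2 = ((D * t ^ 2 / 2 : ℝ) : ℂ) := by push_cast; rfl
      rw [this, Complex.ofReal_re]
    rw [Complex.add_re, Complex.add_re, hD] at h
    have hκ' : -(M * t ^ 3) ≤ (κ * t ^ 3).re := by
      have h1 := (abs_le.1 (Complex.abs_re_le_norm (κ * t ^ 3))).1
      have h2 : ‖κ * (t : ℂ) ^ 3‖ ≤ M * t ^ 3 := by
        rw [norm_mul, norm_pow, Complex.norm_real, Real.norm_of_nonneg ht0.le]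
        gcongr
      linarith
    have hR' := (abs_le.1 (Complex.abs_re_le_norm R)).1
    have key : t ^ 2 * ((1 - x) / (c ^ 2 + t ^ 2) - 2 * (M * t + M * t ^ 2)) ≤ t ^ 2 * -D := by
      have : t ^ 2 * ((1 - x) / (c ^ 2 + t ^ 2)) =
        2 * ((1 - x) / 2 * (t ^ 2 / (c ^ 2 + t ^ 2))) := by ring
      rw [mul_sub, this]
      nlinarith
    exact le_of_mul_le_mul_left key (by positivity)
  have hcont : ContinuousAt
      (fun t : ℝ => (1 - x) / (c ^ 2 + t ^ 2) - 2 * (M * t + M * t ^ 2)) 0 := by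
    have : c ^ 2 + (0 : ℝ) ^ 2 ≠ 0 := by positivity
    fun_prop (disch := assumption)
  have hlim := hcont.tendsto.mono_left (nhdsWithin_le_nhds (s := Set.Ioi 0))
  have hle := le_of_tendsto hlim (by
    filter_upwards [Ioc_mem_nhdsGT hδ] with t ht using hpt t ht)
  simp only [mul_zero, ne_eq, OfNat.ofNat_ne_zero, not_false_eq_true, zero_pow, add_zero,
    sub_zero] at hle
  refine le_trans ?_ hle
  rw [le_div_iff₀ (by positivity)]
  have : c ^ 2 ≤ 1 := by nlinarith [hc.2]
  nlinarith [hx.2]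

/-- The integrand on the vertical line through `c`, divided by its value at `c`. -/
noncomputable def normalizedIntegrand (α c : ℝ) (n k : ℕ) (t : ℝ) : ℂ :=
  oneSubPow α (c + t * Complex.I) ^ k / ((c : ℂ) + t * Complex.I) ^ (n + 1) *
    (c ^ (n + 1) / oneSubPow α c ^ k)

theorem pow_div_pow_eq_exp_log {A B z c x : ℂ} {n k : ℕ} (hA : A ≠ 0) (hB : B ≠ 0)
    (hz : z ≠ 0) (hc : c ≠ 0) (hx : n * x = k) :
    A ^ k / z ^ (n + 1) * (c ^ (n + 1) / B ^ k) =
      Complex.exp (n * (x * (Complex.log A - Complex.log B) -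
        (Complex.log z - Complex.log c))) * (c / z) := by
  rw [mul_sub, ← mul_assoc, hx, Complex.exp_sub, Complex.exp_nat_mul, Complex.exp_nat_mul,
    Complex.exp_sub, Complex.exp_sub, Complex.exp_log hA, Complex.exp_log hB,
    Complex.exp_log hz, Complex.exp_log hc, div_pow, div_pow]
  field_simp
  ring

theorem add_mul_I_ne_zero {c : ℝ} (hc : 0 < c) (t : ℝ) : (c : ℂ) + t * Complex.I ≠ 0 := by
  intro h
  have := congrArg Complex.re h
  simp at this
  exact hc.ne' this

theorem oneSubPow_vertical_ne_zero {α c : ℝ} (hα : α ∈ Set.Ioo (0 : ℝ) 1)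
    (hc : c ∈ Set.Ioo (0 : ℝ) 1) (t : ℝ) : oneSubPow α (c + t * Complex.I) ≠ 0 :=
  Complex.slitPlane_ne_zero (oneSubPow_mem_slitPlane hα (add_mul_I_mem_unitStrip hc t))

theorem continuous_normalizedIntegrand {α c : ℝ} (hc : c ∈ Set.Ioo (0 : ℝ) 1) (n k : ℕ) :
    Continuous (normalizedIntegrand α c n k) := by
  have hline : Continuous fun t : ℝ => (c : ℂ) + t * Complex.I := by fun_prop
  have hF : Continuous fun t : ℝ => oneSubPow α (c + t * Complex.I) :=
    continuous_iff_continuousAt.2 fun t =>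
      ContinuousAt.comp (f := fun t : ℝ => (c : ℂ) + t * Complex.I) (g := oneSubPow α)
        (hasDerivAt_oneSubPow α (add_mul_I_mem_unitStrip hc t).2).continuousAt
        hline.continuousAt
  exact ((hF.pow k).div (hline.pow (n + 1))
    fun t => pow_ne_zero _ (add_mul_I_ne_zero hc.1 t)).mul continuous_const

theorem norm_normalizedIntegrand_le {α c : ℝ} (hα : α ∈ Set.Ioo (0 : ℝ) 1)
    (hc : c ∈ Set.Ioo (0 : ℝ) 1) (k j : ℕ) (t : ℝ) :
    ‖normalizedIntegrand α c (k + j) k t‖ ≤ (c / ‖(c : ℂ) + t * Complex.I‖) ^ (j + 1) := by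
  have hc0 := hc.1
  have hFpos := one_sub_rpow_pos hα.1 hc
  have hz := norm_pos_iff.2 (add_mul_I_ne_zero hc.1 t)
  rw [normalizedIntegrand, oneSubPow_ofReal hc.2.le, norm_mul, norm_div, norm_div, norm_pow,
    norm_pow, norm_pow, norm_pow, Complex.norm_real, Complex.norm_real,
    Real.norm_of_nonneg hc0.le, Real.norm_of_nonneg hFpos.le]
  set B := 1 - (1 - c) ^ α
  set Z := ‖(c : ℂ) + t * Complex.I‖
  calc _ ≤ (B / c * Z) ^ k / Z ^ (k + j + 1) * (c ^ (k + j + 1) / B ^ k) := by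
        have := norm_oneSubPow_vertical_le hα hc t
        gcongr
    _ = _ := by
        rw [div_pow, mul_pow, div_pow, add_assoc, pow_add Z, pow_add c]
        field_simp

theorem exists_sq_mul_pow_le {ρ : ℝ} (h0 : 0 ≤ ρ) (h1 : ρ < 1) :
    ∃ C > (0 : ℝ), ∀ j : ℕ, (j : ℝ) ^ 2 * ρ ^ j ≤ C := by
  obtain ⟨C, hC⟩ := (tendsto_pow_const_mul_const_pow_of_lt_one 2 h0 h1).bddAbove_range
  exact ⟨max C 1, by positivity, fun j => (hC ⟨j, rfl⟩).trans (le_max_left _ _)⟩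

theorem exists_normalizedIntegrand_tail_bound {α b δ : ℝ} (hα : α ∈ Set.Ioo (0 : ℝ) 1)
    (hb : b < 1) (hδ : 0 < δ) :
    ∃ C > (0 : ℝ), ∀ n k : ℕ, 1 ≤ n → k ≤ n → (k : ℝ) / n ≤ b → ∀ c ∈ Set.Ioo (0 : ℝ) 1,
      ∀ t : ℝ, δ ≤ |t| →
        ‖normalizedIntegrand α c n k t‖ ≤ C / (n : ℝ) ^ 2 * (1 + t ^ 2)⁻¹ := by
  set ρ := √((1 + δ ^ 2)⁻¹) with hρ
  have hρ0 : 0 < ρ := Real.sqrt_pos.2 (by positivity)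
  have hρ1 : ρ < 1 := by
    rw [hρ, Real.sqrt_lt' one_pos, one_pow]
    exact inv_lt_one_of_one_lt₀ (by nlinarith)
  obtain ⟨C, hC, hCj⟩ := exists_sq_mul_pow_le hρ0.le hρ1
  have hb' : 0 < 1 - b := by linarith
  refine ⟨C / (ρ * (1 - b) ^ 2), by positivity, ?_⟩
  intro n k hn hkn hkb c hc t ht
  have hc0 := hc.1
  have hn0 : (0 : ℝ) < n := by exact_mod_cast hn
  obtain ⟨j, rfl⟩ := Nat.exists_eq_add_of_le hkn
  have hj : (1 - b) * ((k + j : ℕ) : ℝ) ≤ j := by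
    rw [div_le_iff₀ hn0] at hkb
    push_cast at hkb ⊢
    linarith
  have hjpos : (0 : ℝ) < j := lt_of_lt_of_le (by positivity) hj
  obtain ⟨i, rfl⟩ : ∃ i, j = i + 1 := Nat.exists_eq_succ_of_ne_zero (by
    rintro rfl
    simp at hjpos)
  refine (norm_normalizedIntegrand_le hα hc k (i + 1) t).trans ?_
  set r := c / ‖(c : ℂ) + t * Complex.I‖ with hr
  have hr0 : 0 ≤ r := by positivity
  have hr2 : r ^ 2 ≤ (1 + t ^ 2)⁻¹ := by
    rw [hr, div_pow, norm_add_mul_I_sq, div_le_iff₀ (by positivity), ← div_eq_inv_mul,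
      le_div_iff₀ (by positivity)]
    have : c ^ 2 ≤ 1 := by nlinarith [hc.2]
    nlinarith [sq_nonneg t]
  have hrρ : r ≤ ρ := by
    refine Real.le_sqrt_of_sq_le (hr2.trans ?_)
    rw [← sq_abs t]
    gcongr
  have hpow : r ^ i ≤ C / (ρ * (1 - b) ^ 2) / ((k + (i + 1) : ℕ) : ℝ) ^ 2 := by
    refine (pow_le_pow_left₀ hr0 hrρ i).trans ?_
    rw [div_div, le_div_iff₀ (by positivity)]
    calc ρ ^ i * (ρ * (1 - b) ^ 2 * ((k + (i + 1) : ℕ) : ℝ) ^ 2)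
        = ((1 - b) * ((k + (i + 1) : ℕ) : ℝ)) ^ 2 * ρ ^ (i + 1) := by ring
      _ ≤ ((i + 1 : ℕ) : ℝ) ^ 2 * ρ ^ (i + 1) := by gcongr
      _ ≤ C := hCj (i + 1)
  rw [show i + 1 + 1 = i + 2 by rfl, pow_add]
  exact mul_le_mul hpow hr2 (by positivity) (by positivity)

/-- The normalized integral is Gaussian up to an error of relative size `1 / n`. -/
theorem exists_normalized_integral_bound {α a b : ℝ} (hα : α ∈ Set.Ioo (0 : ℝ) 1)
    (ha : 0 < a) (hb : b < 1) :
    ∃ C > (0 : ℝ), ∃ M > (0 : ℝ), ∀ n k : ℕ, 1 ≤ k → k ≤ n → (k : ℝ) / n ∈ Set.Icc a b →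
      ∀ c ∈ Set.Ioo (0 : ℝ) 1, deriv (hfun α (k / n)) c = 0 →
      0 < |deriv (deriv (hfun α (k / n))) c| ∧ |deriv (deriv (hfun α (k / n))) c| ≤ M ∧
      ‖(∫ t, normalizedIntegrand α c n k t) -
        ((√(2 * Real.pi / (n * |deriv (deriv (hfun α (k / n))) c|)) : ℝ) : ℂ)‖ ≤
        C / (n * √n) := by
  obtain ⟨lo, hi, hlo, hhi, hsaddle⟩ := exists_saddle_mem_Icc hα ha hb
  obtain ⟨δ₀, hδ₀, M, hM, hphase⟩ := exists_phase_expansion hα hlo hhi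
  have hb' : 0 < 1 - b := by linarith
  set δ := min δ₀ (min 1 ((1 - b) / (8 * M))) with hδdef
  have hδ : 0 < δ := lt_min hδ₀ (lt_min one_pos (by positivity))
  obtain ⟨Cl, hCl, hlocal⟩ := exists_local_gaussian_bound (lam0 := 1 - b) hM hlo
  obtain ⟨Ct, hCt, htail⟩ := exists_normalizedIntegrand_tail_bound hα hb hδ
  obtain ⟨Ce, hCe, hexp⟩ := exists_add_sq_add_cube_le_exp (β := (1 - b) / 8) (by positivity)
  set Cg := 1 / δ ^ 2 + M / δ + 1 / lo / δ with hCgdef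
  have hCg : 0 < Cg := by positivity
  have hpi := Real.pi_pos
  refine ⟨(Cl + Cg) * Ce * √(Real.pi / ((1 - b) / 8)) + Ct * Real.pi, by positivity, M, hM, ?_⟩
  intro n k hk hkn hx c hc hd
  have hn : 1 ≤ n := hk.trans hkn
  have hN : (1 : ℝ) ≤ n := by exact_mod_cast hn
  have hN0 : (0 : ℝ) < n := by linarith
  set x : ℝ := (k : ℝ) / n with hxdef
  have hx01 : x ∈ Set.Icc (0 : ℝ) 1 := ⟨ha.le.trans hx.1, hx.2.trans hb.le⟩
  have hcI := hsaddle x hx c hc hd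
  obtain ⟨hDM, κ, hκ, hpt⟩ := hphase x hx01 c hcI hd
  have hD := one_sub_le_of_phase_expansion hα hx01 hc hδ₀ hκ hpt
  set D := deriv (deriv (hfun α x)) c
  have hDb : 1 - b ≤ -D := by linarith [hx.2]
  have hDabs : |D| = -D := abs_of_neg (by linarith)
  refine ⟨by rw [hDabs]; linarith, hDM, ?_⟩
  rw [hDabs]
  have hpoly : ∀ t : ℝ, (t ^ 2 + n * t ^ 4 + (n : ℝ) ^ 2 * t ^ 6) *
      Real.exp (-(n * ((1 - b) / 4) * t ^ 2)) ≤
      Ce / n * Real.exp (-(n * ((1 - b) / 8)) * t ^ 2) := by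
    intro t
    have h := hexp (n * t ^ 2) (by positivity)
    have hsplit : Real.exp (-(n * ((1 - b) / 8)) * t ^ 2) =
        Real.exp ((1 - b) / 8 * (n * t ^ 2)) * Real.exp (-(n * ((1 - b) / 4) * t ^ 2)) := by
      rw [← Real.exp_add]
      congr 1
      ring
    rw [hsplit, ← mul_assoc]
    gcongr
    rw [div_mul_eq_mul_div, le_div_iff₀ hN0]
    linarith
  refine norm_integral_sub_gaussian_le (κ := κ) (μ := -(Complex.I / c)) (by positivity) hCt.le
    hN (by linarith) (continuous_normalizedIntegrand hc n k) fun t => ?_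
  have hterm : 0 ≤ Ct / (n : ℝ) ^ 2 * (1 + t ^ 2)⁻¹ := by positivity
  have hgauss : ∀ K : ℝ, 0 ≤ K → K ≤ Cl + Cg →
      K * (t ^ 2 + n * t ^ 4 + (n : ℝ) ^ 2 * t ^ 6) * Real.exp (-(n * ((1 - b) / 4) * t ^ 2)) ≤
      (Cl + Cg) * Ce / n * Real.exp (-(n * ((1 - b) / 8)) * t ^ 2) := fun K hK hKC => by
    rw [mul_assoc, mul_div_assoc, mul_assoc (Cl + Cg)]
    exact mul_le_mul hKC (hpoly t) (by positivity) (by positivity)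
  rcases le_total |t| δ with ht | ht
  · obtain ⟨R, hR, he⟩ := hpt t (ht.trans (min_le_left _ _))
    have ht1 : |t| ≤ 1 := ht.trans ((min_le_right _ _).trans (min_le_left _ _))
    have htM : 2 * M * |t| ≤ (1 - b) / 4 := by
      have : |t| ≤ (1 - b) / (8 * M) := ht.trans ((min_le_right _ _).trans (min_le_right _ _))
      rw [le_div_iff₀ (by positivity)] at this
      linarith
    have h := hlocal n (-D) c t κ R hN0.le hDb hcI.1 ht1 htM hκ hR
    have hq : normalizedIntegrand α c n k t = Complex.exp ((n : ℝ) *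
        (-((-D : ℝ) * t ^ 2 / 2) + κ * t ^ 3 + R)) * (c / (c + t * Complex.I)) := by
      have hnx : (n : ℂ) * (x : ℂ) = k := by
        rw [hxdef]
        push_cast
        exact mul_div_cancel₀ _ (by exact_mod_cast hN0.ne')
      have hB : oneSubPow α c ≠ 0 := by simpa using oneSubPow_vertical_ne_zero hα hc 0
      rw [normalizedIntegrand, pow_div_pow_eq_exp_log (oneSubPow_vertical_ne_zero hα hc t) hB
        (add_mul_I_ne_zero hc.1 t) (by exact_mod_cast hc.1.ne') hnx, he]
      push_cast
      ring_nf
    rw [hq]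
    exact (h.trans (hgauss Cl hCl.le (by linarith))).trans (le_add_of_nonneg_right hterm)
  · have h1 := htail n k hn hkn hx.2 c hc t ht
    have hμ : ‖-(Complex.I / (c : ℂ))‖ ≤ 1 / lo := by
      rw [norm_neg, norm_div, Complex.norm_I, Complex.norm_real, Real.norm_of_nonneg hc.1.le]
      exact one_div_le_one_div_of_le hlo hcI.1
    have h2 := norm_gaussian_tail_le (κ := κ) (N := n) hM.le (by positivity) hδ hN0.le hb'.le
      hDb ht hκ hμ
    refine (norm_sub_le _ _).trans ?_
    rw [add_comm]
    exact add_le_add (h2.trans (hgauss Cg hCg.le (by linarith))) h1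


theorem exp_neg_mul_hfun {α c : ℝ} (hα : 0 < α) (hc : c ∈ Set.Ioo (0 : ℝ) 1) {n k : ℕ}
    (hn : 1 ≤ n) :
    Real.exp (-(n : ℝ) * hfun α (k / n) c) = (1 - (1 - c) ^ α) ^ k / c ^ n := by
  have hN0 : (n : ℝ) ≠ 0 := by positivity
  have harg : -(n : ℝ) * hfun α (k / n) c =
      k * Real.log (1 - (1 - c) ^ α) - n * Real.log c := by
    rw [hfun]
    field_simp
    ring
  rw [harg, Real.exp_sub, Real.exp_nat_mul, Real.exp_nat_mul,
    Real.exp_log (one_sub_rpow_pos hα hc), Real.exp_log hc.1]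

/-- uniform saddle-point asymptotics of the steepest-descent integral: for
every compact `[a,b] ⊂ (0,1)` there is `C > 0` such that for all `n ≥ 1`, `1 ≤ k ≤ n`
with `x_k = k/n ∈ [a,b]` and `z* = z(x_k)` the saddle point, the vertical-line integral
equals `G_{n,k} = e^{-n h_{x_k}(z*)}/(z* √(2πn|h_{x_k}''(z*)|))` up to a relative error
at most `C/n`. Here `zf` is the saddle-point map `x ↦ z(x)`. -/
theorem steepest_descent_asymptotics (α : ℝ) (hα : α ∈ Set.Ioo (0 : ℝ) 1)
    (zf : ℝ → ℝ)
    (hzf : ∀ x ∈ Set.Ioo (0 : ℝ) 1,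
      zf x ∈ Set.Ioo (0 : ℝ) 1 ∧ deriv (hfun α x) (zf x) = 0)
    (a b : ℝ) (ha : 0 < a) (hab : a ≤ b) (hb : b < 1) :
    ∃ C > (0 : ℝ), ∀ n k : ℕ, 1 ≤ k → k ≤ n → (k : ℝ) / n ∈ Set.Icc a b →
      ‖(2 * Real.pi : ℂ)⁻¹ *
          (∫ t : ℝ, (1 - (1 - ((zf ((k : ℝ) / n) : ℝ) + t * Complex.I)) ^ (α : ℂ)) ^ k /
            (((zf ((k : ℝ) / n) : ℝ) : ℂ) + t * Complex.I) ^ (n + 1)) -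
        ((Real.exp (-(n : ℝ) * hfun α ((k : ℝ) / n) (zf ((k : ℝ) / n))) /
          (zf ((k : ℝ) / n) * Real.sqrt (2 * Real.pi * n *
            |deriv (deriv (hfun α ((k : ℝ) / n))) (zf ((k : ℝ) / n))|)) : ℝ) : ℂ)‖ ≤
      (C / n) * (Real.exp (-(n : ℝ) * hfun α ((k : ℝ) / n) (zf ((k : ℝ) / n))) /
        (zf ((k : ℝ) / n) * Real.sqrt (2 * Real.pi * n *
          |deriv (deriv (hfun α ((k : ℝ) / n))) (zf ((k : ℝ) / n))|))) := by
  obtain ⟨C, hC, M, hM, H⟩ := exists_normalized_integral_bound hα ha hb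
  have hpi := Real.pi_pos
  refine ⟨(2 * Real.pi)⁻¹ * C * √(2 * Real.pi * M), by positivity, ?_⟩
  intro n k hk hkn hx
  have hn : 1 ≤ n := hk.trans hkn
  have hN0 : (0 : ℝ) < n := by exact_mod_cast hn
  obtain ⟨hc, hd⟩ := hzf _ ⟨ha.trans_le hx.1, hx.2.trans_lt hb⟩
  set c := zf ((k : ℝ) / n)
  obtain ⟨hlam, hlamM, hI⟩ := H n k hk hkn hx c hc hd
  set lam := |deriv (deriv (hfun α ((k : ℝ) / n))) c|
  have hc0 := hc.1
  have hB := one_sub_rpow_pos hα.1 hc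
  rw [exp_neg_mul_hfun hα.1 hc hn]
  set B := 1 - (1 - c) ^ α with hBdef
  set P : ℝ := B ^ k / c ^ (n + 1) with hP
  have hPpos : 0 < P := by positivity
  have hG : B ^ k / c ^ n / (c * √(2 * Real.pi * n * lam)) = P / √(2 * Real.pi * n * lam) := by
    rw [hP, div_div, div_div, pow_succ, mul_assoc (c ^ n)]
  have hint : (∫ t : ℝ, (1 - (1 - ((c : ℂ) + t * Complex.I)) ^ (α : ℂ)) ^ k /
      ((c : ℂ) + t * Complex.I) ^ (n + 1)) = P * ∫ t, normalizedIntegrand α c n k t := by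
    rw [← integral_const_mul]
    congr 1
    funext t
    have hBc : (B : ℂ) ≠ 0 := by exact_mod_cast hB.ne'
    have hcc : (c : ℂ) ≠ 0 := by exact_mod_cast hc0.ne'
    rw [normalizedIntegrand, oneSubPow_ofReal hc.2.le, ← hBdef, hP, oneSubPow]
    push_cast
    field_simp
  have hsqrt : (2 * Real.pi)⁻¹ * √(2 * Real.pi / (n * lam)) = 1 / √(2 * Real.pi * n * lam) := by
    have h1 : 2 * Real.pi / (n * lam) = (2 * Real.pi) ^ 2 / (2 * Real.pi * n * lam) := by
      field_simp
    rw [h1, Real.sqrt_div (by positivity), Real.sqrt_sq (by positivity)]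
    field_simp
  have hsplit : ((2 * Real.pi : ℂ)⁻¹ * (P * ∫ t, normalizedIntegrand α c n k t) -
      ((P / √(2 * Real.pi * n * lam) : ℝ) : ℂ)) =
      (((2 * Real.pi)⁻¹ * P : ℝ) : ℂ) * ((∫ t, normalizedIntegrand α c n k t) -
        ((√(2 * Real.pi / (n * lam)) : ℝ) : ℂ)) := by
    have : P / √(2 * Real.pi * n * lam) =
        (2 * Real.pi)⁻¹ * P * √(2 * Real.pi / (n * lam)) := by
      rw [div_eq_mul_one_div, ← hsqrt]
      ring
    rw [this]
    push_cast
    ring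
  rw [hG, hint, hsplit, norm_mul, Complex.norm_real, Real.norm_of_nonneg (by positivity)]
  have hsq : √(2 * Real.pi * n * lam) ≤ √(2 * Real.pi * M) * √n := by
    rw [← Real.sqrt_mul (by positivity)]
    refine Real.sqrt_le_sqrt ?_
    rw [mul_right_comm]
    gcongr
  have hs0 : 0 < √(2 * Real.pi * n * lam) := Real.sqrt_pos.2 (by positivity)
  have hsn : 0 < √(n : ℝ) := Real.sqrt_pos.2 hN0
  calc (2 * Real.pi)⁻¹ * P * _ ≤ (2 * Real.pi)⁻¹ * P * (C / (n * √n)) := by gcongr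
    _ = (2 * Real.pi)⁻¹ * C / n * P * (1 / √n) := by field_simp
    _ ≤ (2 * Real.pi)⁻¹ * C / n * P * (√(2 * Real.pi * M) / √(2 * Real.pi * n * lam)) := by
        refine mul_le_mul_of_nonneg_left ?_ (by positivity)
        rw [div_le_div_iff₀ hsn hs0, one_mul]
        exact hsq
    _ = _ := by ring
end

section
/- There exist constants C > 0 and δ > 0 such that for all x ∈ (0,δ), | (1 − z(x)) / ( α^{1/(1−α)} · x^{1/(1−α)} ) − 1 | ≤ C·x^{α/(1−α)}; in other words, as x → 0⁺, 1 − z(x) = α^{1/(1−α)} x^{1/(1−α)} (1 + O(x^{α/(1−α)})). -/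
/-- Convexity of `s ↦ s ^ p` bounds it by its chord on `[1, 2]`. -/
lemma rpow_sub_one_le_of_mem_Icc {p r : ℝ} (hp : 1 ≤ p) (h1 : 1 ≤ r) (h2 : r ≤ 2) :
    r ^ p - 1 ≤ (r - 1) * 2 ^ p := by
  have h := (convexOn_rpow hp).2 (show (1 : ℝ) ∈ Set.Ici 0 by simp)
    (show (2 : ℝ) ∈ Set.Ici 0 by simp) (show 0 ≤ 2 - r by linarith)
    (show 0 ≤ r - 1 by linarith) (by ring)
  simp only [smul_eq_mul, Real.one_rpow] at h
  rw [show (2 - r) * 1 + (r - 1) * 2 = r by ring] at h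
  linarith

/-- The saddle point equation in the variable `w = 1 - z`, with negative powers cleared. -/
lemma rpow_one_sub_mul_eq_of_saddle {α x w : ℝ} (hw : 0 < w)
    (h : 1 - w ^ α - α * x * (1 - w) * w ^ (α - 1) = 0) :
    w ^ (1 - α) * (1 - w ^ α) = α * x * (1 - w) := by
  have hinv : w ^ (1 - α) * w ^ (α - 1) = 1 := by
    rw [← Real.rpow_add hw]; simp
  linear_combination w ^ (1 - α) * h + α * x * (1 - w) * hinv

/-- A solution `w` of the saddle point equation satisfies `w ^ (1 - α) ≤ x`. -/
lemma rpow_one_sub_le_of_saddle {α x w : ℝ} (h0 : 0 < α) (h1 : α < 1) (hw : 0 < w) (hw1 : w < 1)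
    (h : w ^ (1 - α) * (1 - w ^ α) = α * x * (1 - w)) : w ^ (1 - α) ≤ x := by
  have hb : w ^ α ≤ 1 + α * (w - 1) := by
    have := rpow_one_add_le_one_add_mul_self (s := w - 1) (by linarith) h0.le h1.le
    simpa using this
  have hpos : 0 < α * (1 - w) := mul_pos h0 (by linarith)
  refine le_of_mul_le_mul_right ?_ hpos
  calc w ^ (1 - α) * (α * (1 - w)) ≤ w ^ (1 - α) * (1 - w ^ α) := by
        gcongr
        linarith
    _ = x * (α * (1 - w)) := by rw [h]; ring

/-- as `x → 0⁺`, `1 - z(x) = α^{1/(1-α)} x^{1/(1-α)} (1 + O(x^{α/(1-α)}))`,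
where `z(x)` is the unique root in `(0,1)` of `h_x'(z) = 0`, equivalently of
`1-(1-z)^α - αxz(1-z)^{α-1} = 0`. -/
theorem saddle_point_asymptotics_near_zero (α : ℝ) (hα : α ∈ Set.Ioo (0 : ℝ) 1)
    (zf : ℝ → ℝ)
    (hzf : ∀ x ∈ Set.Ioo (0 : ℝ) 1, zf x ∈ Set.Ioo (0 : ℝ) 1 ∧
      1 - (1 - zf x) ^ α - α * x * zf x * (1 - zf x) ^ (α - 1) = 0) :
    ∃ C > (0 : ℝ), ∃ δ > (0 : ℝ), ∀ x : ℝ, 0 < x → x < δ →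
      |(1 - zf x) / (α ^ (1 / (1 - α)) * x ^ (1 / (1 - α))) - 1| ≤
        C * x ^ (α / (1 - α)) := by
  obtain ⟨h0, h1⟩ := hα
  have hα' : 0 < 1 - α := by linarith
  have hp : 1 ≤ 1 / (1 - α) := by rw [le_div_iff₀ hα']; linarith
  have hδ1 : (1 / 2 : ℝ) ^ ((1 - α) / α) ≤ 1 :=
    Real.rpow_le_one (by norm_num) (by norm_num) (by positivity)
  refine ⟨2 * 2 ^ (1 / (1 - α)), by positivity, (1 / 2) ^ ((1 - α) / α), by positivity, ?_⟩
  intro x hx hxδ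
  obtain ⟨⟨hz0, hz1⟩, heq⟩ := hzf x ⟨hx, by linarith⟩
  obtain ⟨w, hw⟩ : ∃ w, w = 1 - zf x := ⟨_, rfl⟩
  rw [show zf x = 1 - w by linarith, sub_sub_cancel] at heq
  rw [← hw]
  have hw0 : 0 < w := by linarith
  have hw1 : w < 1 := by linarith
  have hsaddle := rpow_one_sub_mul_eq_of_saddle hw0 heq
  have hwx := rpow_one_sub_le_of_saddle h0 h1 hw0 hw1 hsaddle
  have ht : x ^ (α / (1 - α)) ≤ 1 / 2 := by
    calc x ^ (α / (1 - α)) ≤ ((1 / 2 : ℝ) ^ ((1 - α) / α)) ^ (α / (1 - α)) := by gcongr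
      _ = 1 / 2 := by
        rw [← Real.rpow_mul (by norm_num), div_mul_div_cancel₀ h0.ne', div_self hα'.ne',
          Real.rpow_one]
  have hwt : w ^ α ≤ x ^ (α / (1 - α)) := by
    calc w ^ α = (w ^ (1 - α)) ^ (α / (1 - α)) := by
          rw [← Real.rpow_mul hw0.le, mul_div_cancel₀ _ hα'.ne']
      _ ≤ x ^ (α / (1 - α)) := by gcongr
  have hwα : w ≤ w ^ α := by
    simpa using Real.rpow_le_rpow_of_exponent_ge hw0 hw1.le h1.le
  have hden : 0 < 1 - w ^ α := by linarith
  obtain ⟨r, hr⟩ : ∃ r, r = (1 - w) / (1 - w ^ α) := ⟨_, rfl⟩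
  have hr1 : 1 ≤ r := by rw [hr, le_div_iff₀ hden]; linarith
  have hrt : r - 1 ≤ 2 * x ^ (α / (1 - α)) := by
    rw [hr, div_sub_one hden.ne', div_le_iff₀ hden]
    nlinarith [Real.rpow_nonneg hx.le (α / (1 - α))]
  have hquot : w / (α ^ (1 / (1 - α)) * x ^ (1 / (1 - α))) = r ^ (1 / (1 - α)) := by
    rw [← Real.mul_rpow h0.le hx.le, div_eq_iff (by positivity),
      ← Real.mul_rpow (by linarith) (by positivity)]
    have hrw : r * (α * x) = w ^ (1 - α) := by
      rw [hr, div_mul_eq_mul_div, div_eq_iff hden.ne', hsaddle]; ring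
    rw [hrw, ← Real.rpow_mul hw0.le, mul_one_div_cancel hα'.ne', Real.rpow_one]
  rw [hquot, abs_of_nonneg (sub_nonneg.2 (Real.one_le_rpow hr1 (by linarith)))]
  calc r ^ (1 / (1 - α)) - 1 ≤ (r - 1) * 2 ^ (1 / (1 - α)) :=
        rpow_sub_one_le_of_mem_Icc hp hr1 (by linarith)
    _ ≤ 2 * x ^ (α / (1 - α)) * 2 ^ (1 / (1 - α)) := by gcongr
    _ = 2 * 2 ^ (1 / (1 - α)) * x ^ (α / (1 - α)) := by ring
end
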